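/- arXiv:2511.12942 — 2 statements merged into one kernel-verified Lean document; each statement's English description precedes it below -/
import Mathlib

section
/- Let n ≥ 3 and let Ω ⊂ ℝⁿ be an open set (not necessarily bounded) whose boundary ∂Ω is (n−1)-dimensional Ahlfors–David regular with constant C_AR. Then there exists a constant C = C(n, C_AR) such that for every u ∈ W^{1,2}(Ω) ∩ C(Ω̄) with u = 0 on ∂Ω one has ∫_Ω (u(x)/δ(x))² dx ≤ C ∫_Ω |∇u(x)|² dx, where δ(x) := dist(x, ∂Ω). -/
open MeasureTheory Metric Set

noncomputable section

/-- Distance to the boundary of `Ω`. -/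
def bdryDist {n : ℕ} (Ω : Set (EuclideanSpace ℝ (Fin n))) (x : EuclideanSpace ℝ (Fin n)) : ℝ :=
  Metric.infDist x (frontier Ω)

/-- `E` is `(n-1)`-dimensional Ahlfors–David regular with constant `CAR`. -/
def IsADR {n : ℕ} (E : Set (EuclideanSpace ℝ (Fin n))) (CAR : ℝ) : Prop :=
  ∀ q ∈ E, ∀ r : ℝ, 0 < r → ENNReal.ofReal r ≤ EMetric.diam E →
    ENNReal.ofReal (CAR⁻¹ * r ^ (n - 1)) ≤ μH[(n : ℝ) - 1] (Metric.ball q r ∩ E) ∧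
      μH[(n : ℝ) - 1] (Metric.ball q r ∩ E) ≤ ENNReal.ofReal (CAR * r ^ (n - 1))

open scoped ENNReal

theorem lintegral_inv_enorm_pow_le {E : Type*} [NormedAddCommGroup E] [MeasurableSpace E]
    [BorelSpace E] {μ : Measure E} {m : ℕ} {K : ℝ} (hK : 0 ≤ K) {y : E}
    (hμ : ∀ r : ℝ, 0 < r → μ (ball y r) ≤ ENNReal.ofReal (K * r ^ m)) {d : ℝ} (hd : 0 < d)
    (hfar : ∀ᵐ z ∂μ, d ≤ dist y z) :
    ∫⁻ z, (‖y - z‖ₑ ^ (m + 1))⁻¹ ∂μ ≤ ENNReal.ofReal (2 ^ (m + 1) * K) * (ENNReal.ofReal d)⁻¹ := by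
  have hpt : ∀ᵐ z ∂μ, (‖y - z‖ₑ ^ (m + 1))⁻¹ ≤ ∑' k : ℕ,
      (ball y (2 ^ (k + 1) * d)).indicator
        (fun _ => ENNReal.ofReal (((2 ^ k * d) ^ (m + 1))⁻¹)) z := by
    filter_upwards [hfar] with z hz
    obtain ⟨k, hk1, hk2⟩ := exists_nat_pow_near ((one_le_div hd).2 hz) (one_lt_two)
    rw [le_div_iff₀ hd] at hk1
    rw [div_lt_iff₀ hd] at hk2
    refine le_trans ?_ (ENNReal.le_tsum k)
    rw [indicator_of_mem (by rwa [mem_ball, dist_comm]),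
      ENNReal.ofReal_inv_of_pos (by positivity), ENNReal.ofReal_pow (by positivity)]
    gcongr
    rw [← edist_eq_enorm_sub, edist_dist]
    exact ENNReal.ofReal_le_ofReal hk1
  refine (lintegral_mono_ae hpt).trans ?_
  rw [lintegral_tsum fun k => (measurable_const.indicator measurableSet_ball).aemeasurable]
  have hterm : ∀ k : ℕ, ∫⁻ z, (ball y (2 ^ (k + 1) * d)).indicator
        (fun _ => ENNReal.ofReal (((2 ^ k * d) ^ (m + 1))⁻¹)) z ∂μ ≤
      ENNReal.ofReal (2 ^ m * K / d * (1 / 2) ^ k) := by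
    intro k
    rw [lintegral_indicator_const measurableSet_ball]
    refine (mul_le_mul_right (hμ _ (by positivity)) _).trans ?_
    rw [← ENNReal.ofReal_mul (by positivity)]
    refine ENNReal.ofReal_le_ofReal (le_of_eq ?_)
    have e : (2 ^ (k + 1) * d) ^ m = 2 ^ m * (2 ^ k * d) ^ m := by rw [← mul_pow]; ring
    rw [e, pow_succ (2 ^ k * d), one_div, inv_pow]
    field_simp
  refine (ENNReal.tsum_le_tsum hterm).trans ?_
  rw [← ENNReal.ofReal_tsum_of_nonneg (fun k => by positivity)
    (summable_geometric_two.mul_left _), tsum_mul_left, tsum_geometric_two,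
    ← ENNReal.ofReal_inv_of_pos hd, ← ENNReal.ofReal_mul (by positivity)]
  refine ENNReal.ofReal_le_ofReal (le_of_eq ?_)
  field_simp
  ring

section Cone

variable {E : Type*} [NormedAddCommGroup E] [NormedSpace ℝ E] [FiniteDimensional ℝ E]
  [MeasurableSpace E] [BorelSpace E]

theorem lintegral_comp_homothety (ν : Measure E) [ν.IsAddHaarMeasure] {f : E → ℝ≥0∞}
    (hf : Measurable f) (q : E) {s : ℝ} (hs : 0 < s) :
    ∫⁻ x, f (q + s • (x - q)) ∂ν = (ENNReal.ofReal s ^ Module.finrank ℝ E)⁻¹ * ∫⁻ x, f x ∂ν := by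
  calc ∫⁻ x, f (q + s • (x - q)) ∂ν = ∫⁻ y, f (q + s • y) ∂ν :=
        lintegral_sub_right_eq_self (fun y => f (q + s • y)) q
    _ = ∫⁻ y, f (q + y) ∂(Measure.map (fun x => s • x) ν) := by
        rw [lintegral_map (by fun_prop) (by fun_prop)]
    _ = (ENNReal.ofReal s ^ Module.finrank ℝ E)⁻¹ * ∫⁻ y, f (q + y) ∂ν := by
        rw [Measure.map_addHaar_smul ν hs.ne', lintegral_smul_measure, smul_eq_mul,
          abs_of_pos (by positivity), ENNReal.ofReal_inv_of_pos (by positivity),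
          ENNReal.ofReal_pow hs.le]
    _ = _ := by rw [lintegral_add_left_eq_self f q]

theorem lintegral_cone_eq (ν : Measure E) [ν.IsAddHaarMeasure] {h : E → ℝ≥0∞} (hh : Measurable h)
    (z : E) :
    ∫⁻ x, (‖x - z‖ₑ ^ Module.finrank ℝ E)⁻¹ * (∫⁻ t in Ioo (0 : ℝ) 1, h (x + t • (z - x))) ∂ν =
      ∫⁻ y, (‖y - z‖ₑ ^ Module.finrank ℝ E)⁻¹ * h y ∂ν := by
  set N := Module.finrank ℝ E
  have h1 : ∀ x, (‖x - z‖ₑ ^ N)⁻¹ * ∫⁻ t in Ioo (0 : ℝ) 1, h (x + t • (z - x)) =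
      ∫⁻ t in Ioo (0 : ℝ) 1, (‖x - z‖ₑ ^ N)⁻¹ * h (x + t • (z - x)) := fun x =>
    (lintegral_const_mul _ (by fun_prop)).symm
  simp_rw [h1]
  rw [lintegral_lintegral_swap (by fun_prop)]
  have h2 : ∀ t ∈ Ioo (0 : ℝ) 1, ∫⁻ x, (‖x - z‖ₑ ^ N)⁻¹ * h (x + t • (z - x)) ∂ν =
      ∫⁻ y, (‖y - z‖ₑ ^ N)⁻¹ * h y ∂ν := by
    intro t ht
    have hs : 0 < 1 - t := by linarith [ht.2]
    have hs0 : ENNReal.ofReal (1 - t) ^ N ≠ 0 := pow_ne_zero _ (by simpa using hs)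
    have hst : ENNReal.ofReal (1 - t) ^ N ≠ ∞ := by simp
    have key := lintegral_comp_homothety ν
      (f := fun y => (‖y - z‖ₑ ^ N)⁻¹ * h y) (by fun_prop) z hs
    have h3 : ∀ x, (‖x - z‖ₑ ^ N)⁻¹ * h (x + t • (z - x)) =
        ENNReal.ofReal (1 - t) ^ N *
          ((‖z + (1 - t) • (x - z) - z‖ₑ ^ N)⁻¹ * h (z + (1 - t) • (x - z))) := by
      intro x
      have e1 : z + (1 - t) • (x - z) - z = (1 - t) • (x - z) := by abel
      have e2 : z + (1 - t) • (x - z) = x + t • (z - x) := by module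
      rw [e1, e2, enorm_smul, mul_pow, Real.enorm_eq_ofReal hs.le,
        ENNReal.mul_inv (Or.inl hs0) (Or.inl hst), ← mul_assoc, ← mul_assoc,
        ENNReal.mul_inv_cancel hs0 hst, one_mul]
    simp_rw [h3]
    rw [lintegral_const_mul _ (by fun_prop), key, ← mul_assoc, ENNReal.mul_inv_cancel hs0 hst,
      one_mul]
  rw [setLIntegral_congr_fun measurableSet_Ioo h2]
  simp


theorem setLIntegral_div_sq_le_of_measure_ball (ν μ : Measure E) [ν.IsAddHaarMeasure] [SFinite μ]
    {m : ℕ} (hm : Module.finrank ℝ E = m + 1) {w h : E → ℝ≥0∞} (hh : Measurable h)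
    (hseg : ∀ a b, w a ≤ w b + ‖b - a‖ₑ * ∫⁻ t in Ioo (0 : ℝ) 1, h (a + t • (b - a)))
    (hw0 : ∀ᵐ z ∂μ, w z = 0) {δ : E → ℝ} (hδ : ∀ x, ∀ᵐ z ∂μ, δ x ≤ dist x z)
    (hh0 : ∀ x, δ x ≤ 0 → h x = 0) {k K : ℝ} (hk : 0 < k) (hK : 0 ≤ K)
    (hup : ∀ y, ∀ r : ℝ, 0 < r → μ (ball y r) ≤ ENNReal.ofReal (K * r ^ m))
    {s : Set E} (hs : MeasurableSet s) (hs0 : ∀ x ∈ s, 0 < δ x)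
    (hlow : ∀ x ∈ s, ENNReal.ofReal (k * δ x ^ m) ≤ μ (ball x (2 * δ x))) :
    ∫⁻ x in s, w x * (ENNReal.ofReal (δ x) ^ 2)⁻¹ ∂ν ≤
      ENNReal.ofReal (2 ^ (2 * m + 3) * K / k) *
        ∫⁻ x, h x * (ENNReal.ofReal (δ x))⁻¹ ∂ν := by
  have hpt : ∀ x ∈ s, w x * (ENNReal.ofReal (δ x) ^ 2)⁻¹ ≤ ENNReal.ofReal (2 ^ (m + 2) / k) *
      ∫⁻ z, (‖x - z‖ₑ ^ (m + 1))⁻¹ * (∫⁻ t in Ioo (0 : ℝ) 1, h (x + t • (z - x))) ∂μ := by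
    intro x hx
    set D := ENNReal.ofReal (δ x) with hD
    have hD0 : D ≠ 0 := by simpa [hD] using hs0 x hx
    have hDt : D ≠ ∞ := by simp [hD]
    set Q := ∫⁻ z, (‖x - z‖ₑ ^ (m + 1))⁻¹ * (∫⁻ t in Ioo (0 : ℝ) 1, h (x + t • (z - x))) ∂μ
    have h1 : ENNReal.ofReal k * D ^ m * w x ≤ (2 * D) ^ (m + 2) * Q := by
      calc ENNReal.ofReal k * D ^ m * w x
          = ENNReal.ofReal (k * δ x ^ m) * w x := by
            rw [ENNReal.ofReal_mul hk.le, ENNReal.ofReal_pow (hs0 x hx).le]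
        _ ≤ μ (ball x (2 * δ x)) * w x := by gcongr; exact hlow x hx
        _ = ∫⁻ z in ball x (2 * δ x), w x ∂μ := by rw [setLIntegral_const, mul_comm]
        _ ≤ ∫⁻ z in ball x (2 * δ x), (2 * D) ^ (m + 2) * ((‖x - z‖ₑ ^ (m + 1))⁻¹ *
              (∫⁻ t in Ioo (0 : ℝ) 1, h (x + t • (z - x)))) ∂μ := by
            refine setLIntegral_mono_ae (by fun_prop) ?_
            filter_upwards [hw0, hδ x] with z hz0 hz hzb
            have hlt : ‖x - z‖ₑ ≤ 2 * D := by
              rw [← edist_eq_enorm_sub, edist_dist, hD, ← ENNReal.ofReal_ofNat,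
                ← ENNReal.ofReal_mul (by norm_num), dist_comm]
              exact ENNReal.ofReal_le_ofReal (mem_ball.1 hzb).le
            have he0 : ‖x - z‖ₑ ≠ 0 := by
              have := (hs0 x hx).trans_le hz
              rw [← edist_eq_enorm_sub]
              simpa using dist_pos.1 this
            refine (hseg x z).trans ?_
            rw [hz0, zero_add, ← mul_assoc, ← edist_eq_enorm_sub z x, edist_comm,
              edist_eq_enorm_sub]
            gcongr
            rw [← div_eq_mul_inv, ENNReal.le_div_iff_mul_le (by simp [he0]) (by simp)]
            calc ‖x - z‖ₑ * ‖x - z‖ₑ ^ (m + 1) = ‖x - z‖ₑ ^ (m + 2) := by ring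
              _ ≤ _ := by gcongr
        _ ≤ ∫⁻ z, (2 * D) ^ (m + 2) * ((‖x - z‖ₑ ^ (m + 1))⁻¹ *
              (∫⁻ t in Ioo (0 : ℝ) 1, h (x + t • (z - x)))) ∂μ := setLIntegral_le_lintegral _ _
        _ = _ := lintegral_const_mul _ (by fun_prop)
    have hk0 : ENNReal.ofReal k ≠ 0 := by simpa using hk
    rw [← div_eq_mul_inv, ENNReal.div_le_iff (by simp [hD0]) (by simp [hDt]),
      ENNReal.ofReal_div_of_pos hk, ENNReal.ofReal_pow (by norm_num), ENNReal.ofReal_ofNat]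
    have hDm0 : D ^ m ≠ 0 := pow_ne_zero _ hD0
    have hDmt : D ^ m ≠ ∞ := ENNReal.pow_ne_top hDt
    rw [mul_comm _ (w x), ← ENNReal.le_div_iff_mul_le (Or.inl (mul_ne_zero hk0 hDm0))
      (Or.inl (ENNReal.mul_ne_top (by simp) hDmt))] at h1
    refine h1.trans (le_of_eq ?_)
    rw [div_eq_mul_inv, div_eq_mul_inv, ENNReal.mul_inv (Or.inl hk0) (Or.inl (by simp)), mul_pow,
      pow_add D m 2]
    calc 2 ^ (m + 2) * (D ^ m * D ^ 2) * Q * ((ENNReal.ofReal k)⁻¹ * (D ^ m)⁻¹)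
        = (D ^ m * (D ^ m)⁻¹) * (2 ^ (m + 2) * (ENNReal.ofReal k)⁻¹ * Q * D ^ 2) := by ring
      _ = _ := by rw [ENNReal.mul_inv_cancel hDm0 hDmt, one_mul]
  calc ∫⁻ x in s, w x * (ENNReal.ofReal (δ x) ^ 2)⁻¹ ∂ν
      ≤ ∫⁻ x in s, ENNReal.ofReal (2 ^ (m + 2) / k) *
        ∫⁻ z, (‖x - z‖ₑ ^ (m + 1))⁻¹ *
          (∫⁻ t in Ioo (0 : ℝ) 1, h (x + t • (z - x))) ∂μ ∂ν :=
        setLIntegral_mono' hs hpt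
    _ ≤ ∫⁻ x, ENNReal.ofReal (2 ^ (m + 2) / k) *
        ∫⁻ z, (‖x - z‖ₑ ^ (m + 1))⁻¹ *
          (∫⁻ t in Ioo (0 : ℝ) 1, h (x + t • (z - x))) ∂μ ∂ν := setLIntegral_le_lintegral _ _
    _ = ENNReal.ofReal (2 ^ (m + 2) / k) * ∫⁻ x, ∫⁻ z, (‖x - z‖ₑ ^ (m + 1))⁻¹ *
          (∫⁻ t in Ioo (0 : ℝ) 1, h (x + t • (z - x))) ∂μ ∂ν :=
        lintegral_const_mul _ (by fun_prop)
    _ = ENNReal.ofReal (2 ^ (m + 2) / k) * ∫⁻ z, ∫⁻ y, (‖y - z‖ₑ ^ (m + 1))⁻¹ * h y ∂ν ∂μ := by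
        rw [lintegral_lintegral_swap (by fun_prop), ← hm]
        simp_rw [lintegral_cone_eq ν hh]
    _ = ENNReal.ofReal (2 ^ (m + 2) / k) *
          ∫⁻ y, (∫⁻ z, (‖y - z‖ₑ ^ (m + 1))⁻¹ ∂μ) * h y ∂ν := by
        rw [lintegral_lintegral_swap (by fun_prop)]
        congr 2 with y
        exact lintegral_mul_const _ (by fun_prop)
    _ ≤ ENNReal.ofReal (2 ^ (m + 2) / k) * ∫⁻ y, ENNReal.ofReal (2 ^ (m + 1) * K) *
          (h y * (ENNReal.ofReal (δ y))⁻¹) ∂ν := by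
        refine mul_le_mul_right (lintegral_mono fun y => ?_) _
        rcases le_or_gt (δ y) 0 with hy | hy
        · simp [hh0 y hy]
        · rw [mul_comm (h y), ← mul_assoc]
          refine mul_le_mul_left ?_ _
          exact lintegral_inv_enorm_pow_le hK (hup y) hy (hδ y)
    _ = _ := by
        rw [lintegral_const_mul' _ _ ENNReal.ofReal_ne_top, ← mul_assoc,
          ← ENNReal.ofReal_mul (by positivity)]
        congr 2
        ring

theorem lintegral_div_enorm_sq_le (ν : Measure E) [ν.IsAddHaarMeasure]
    (hm : 3 ≤ Module.finrank ℝ E) {w h : E → ℝ≥0∞} (hw : Measurable w) (hh : Measurable h)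
    (hseg : ∀ a b, w a ≤ w b + ‖b - a‖ₑ * ∫⁻ t in Ioo (0 : ℝ) 1, h (a + t • (b - a))) (q : E)
    (hfin : ∫⁻ x, w x * (‖x - q‖ₑ ^ 2)⁻¹ ∂ν ≠ ∞) :
    ∫⁻ x, w x * (‖x - q‖ₑ ^ 2)⁻¹ ∂ν ≤ 2 * ∫⁻ x, h x * ‖x - q‖ₑ⁻¹ ∂ν := by
  set N := Module.finrank ℝ E with hN
  have : Nontrivial E := Module.nontrivial_of_finrank_pos (R := ℝ) (by omega)
  have hscale : ∀ c : ℝ, 1 ≤ c → ∀ j : ℕ, j < N → ∀ g : E → ℝ≥0∞, Measurable g →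
      ∫⁻ x, g (q + c • (x - q)) * (‖x - q‖ₑ ^ j)⁻¹ ∂ν ≤
        (ENNReal.ofReal c)⁻¹ * ∫⁻ x, g x * (‖x - q‖ₑ ^ j)⁻¹ ∂ν := by
    intro c hc j hj g hg
    have hc0 : 0 < c := by linarith
    have key := lintegral_comp_homothety ν
      (f := fun x => g x * (‖x - q‖ₑ ^ j)⁻¹) (by fun_prop) q hc0
    set C := ENNReal.ofReal c with hC
    have hC0 : C ≠ 0 := by simpa [hC] using hc0
    have hCt : C ≠ ∞ := by simp [hC]
    have hC1 : 1 ≤ C := by simpa [hC] using hc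
    have e : ∀ x, g (q + c • (x - q)) * (‖x - q‖ₑ ^ j)⁻¹ =
        C ^ j * (g (q + c • (x - q)) * (‖q + c • (x - q) - q‖ₑ ^ j)⁻¹) := by
      intro x
      rw [add_sub_cancel_left, enorm_smul, Real.enorm_eq_ofReal hc0.le, mul_pow,
        ENNReal.mul_inv (Or.inl (pow_ne_zero _ hC0)) (Or.inl (ENNReal.pow_ne_top hCt)),
        mul_left_comm, ← mul_assoc (C ^ j),
        ENNReal.mul_inv_cancel (pow_ne_zero _ hC0) (ENNReal.pow_ne_top hCt), one_mul]
    simp_rw [e]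
    rw [lintegral_const_mul _ (by fun_prop), key, ← mul_assoc]
    gcongr
    obtain ⟨i, hi⟩ := Nat.exists_eq_add_of_lt hj
    rw [← hN, hi, ← div_eq_mul_inv, ENNReal.div_le_iff (by simp [hC0]) (by simp [hCt])]
    calc C ^ j = C⁻¹ * C * C ^ j := by rw [ENNReal.inv_mul_cancel hC0 hCt, one_mul]
      _ ≤ C⁻¹ * C * C ^ j * C ^ i := le_mul_of_one_le_right' (one_le_pow₀ hC1)
      _ = _ := by ring
  set J := ∫⁻ x, w x * (‖x - q‖ₑ ^ 2)⁻¹ ∂ν with hJ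
  set H := ∫⁻ x, h x * ‖x - q‖ₑ⁻¹ ∂ν with hH
  have hray : ∀ x, q + (2 : ℝ) • (x - q) - x = x - q := fun x => by module
  have hne : ∀ᵐ x ∂ν, x ≠ q := by
    rw [ae_iff]; simp
  have hJle : J ≤ 2⁻¹ * J + H := by
    calc J ≤ ∫⁻ x, (w (q + (2 : ℝ) • (x - q)) * (‖x - q‖ₑ ^ 2)⁻¹ +
          ∫⁻ t in Ioo (0 : ℝ) 1, h (q + (1 + t) • (x - q)) * (‖x - q‖ₑ ^ 1)⁻¹) ∂ν := by
          refine lintegral_mono_ae ?_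
          filter_upwards [hne] with x hx
          have hx0 : ‖x - q‖ₑ ≠ 0 := by simpa [sub_eq_zero] using hx
          have := hseg x (q + (2 : ℝ) • (x - q))
          rw [hray] at this
          refine (mul_le_mul_left this _).trans (le_of_eq ?_)
          have e3 : ∀ t : ℝ, x + t • (x - q) = q + (1 + t) • (x - q) := fun t => by module
          simp_rw [e3]
          rw [add_mul, lintegral_mul_const _ (by fun_prop), pow_one]
          congr 1
          rw [mul_right_comm, mul_comm]
          congr 1
          rw [pow_two, ENNReal.mul_inv (Or.inl hx0) (Or.inl (by simp)), ← mul_assoc,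
            ENNReal.mul_inv_cancel hx0 (by simp), one_mul]
      _ = ∫⁻ x, w (q + (2 : ℝ) • (x - q)) * (‖x - q‖ₑ ^ 2)⁻¹ ∂ν +
          ∫⁻ t in Ioo (0 : ℝ) 1, ∫⁻ x, h (q + (1 + t) • (x - q)) * (‖x - q‖ₑ ^ 1)⁻¹ ∂ν := by
          rw [lintegral_add_left (by fun_prop), lintegral_lintegral_swap (by fun_prop)]
      _ ≤ 2⁻¹ * J + ∫⁻ t in Ioo (0 : ℝ) 1, H := by
          gcongr ?_ + ?_
          · simpa using hscale 2 (by norm_num) 2 (by omega) w hw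
          · refine setLIntegral_mono' measurableSet_Ioo fun t ht => ?_
            refine (hscale (1 + t) (by linarith [ht.1]) 1 (by omega) h hh).trans ?_
            simp only [pow_one]
            refine mul_le_of_le_one_left' ?_
            simp [ht.1.le]
      _ = _ := by simp
  have h2 : J = 2⁻¹ * J + 2⁻¹ * J := by
    rw [← add_mul, ENNReal.inv_two_add_inv_two, one_mul]
  have h3 : 2⁻¹ * J ≤ H := by
    refine (ENNReal.add_le_add_iff_left (a := 2⁻¹ * J) (ENNReal.mul_ne_top (by simp) hfin)).1 ?_
    rwa [← h2]
  calc J = 2 * (2⁻¹ * J) := by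
        rw [← mul_assoc, ENNReal.mul_inv_cancel (by simp) (by simp), one_mul]
    _ ≤ 2 * H := by gcongr

end Cone

theorem indicator_sq_le_add_lintegral_segment {E : Type*} [NormedAddCommGroup E] [NormedSpace ℝ E]
    [MeasurableSpace E] [BorelSpace E] {Ω : Set E} {u : E → ℝ} (hΩ : IsOpen Ω)
    (hc : ContinuousOn u (closure Ω)) (hd : ∀ x ∈ Ω, DifferentiableAt ℝ u x)
    (h0 : ∀ x ∈ frontier Ω, u x = 0) (a b : E) :
    Ω.indicator (fun x => ENNReal.ofReal (u x ^ 2)) a ≤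
      Ω.indicator (fun x => ENNReal.ofReal (u x ^ 2)) b + ‖b - a‖ₑ *
        ∫⁻ t in Ioo (0 : ℝ) 1, Ω.indicator
          (fun x => ENNReal.ofReal (2 * |u x| * ‖fderiv ℝ u x‖)) (a + t • (b - a)) := by
  rcases eq_or_ne a b with rfl | hab
  · exact le_self_add
  have hba : ‖b - a‖ₑ ≠ 0 := by simpa [sub_eq_zero] using hab.symm
  set v := Ω.indicator u with hv
  have hvc : Continuous v := continuous_indicator h0 hc
  set H := Ω.indicator (fun x => 2 * |u x| * ‖fderiv ℝ u x‖) with hH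
  have hHv : H = fun x => 2 * |v x| * ‖fderiv ℝ u x‖ := by
    ext x
    by_cases hx : x ∈ Ω <;> simp [hH, hv, hx]
  have hHm : Measurable H := by
    rw [hHv]
    exact ((measurable_const.mul hvc.measurable.abs)).mul (measurable_fderiv ℝ u).norm
  have hH0 : ∀ x, 0 ≤ H x := fun x => by rw [hHv]; positivity
  have ew : ∀ x, Ω.indicator (fun x => ENNReal.ofReal (u x ^ 2)) x = ENNReal.ofReal (v x ^ 2) :=
    fun x => by by_cases hx : x ∈ Ω <;> simp [hv, hx]
  have eh : ∀ x, Ω.indicator (fun x => ENNReal.ofReal (2 * |u x| * ‖fderiv ℝ u x‖)) x =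
      ENNReal.ofReal (H x) := fun x => by by_cases hx : x ∈ Ω <;> simp [hH, hx]
  simp only [ew, eh]
  set γ : ℝ → E := fun t => a + t • (b - a) with hγ
  have hγc : Continuous γ := by fun_prop
  by_cases htop : ∫⁻ t in Ioo (0 : ℝ) 1, ENNReal.ofReal (H (γ t)) = ∞
  · rw [htop, ENNReal.mul_top hba]
    simp
  have hint : IntegrableOn (fun t => H (γ t)) (Ioo 0 1) := by
    refine ⟨(hHm.comp hγc.measurable).aestronglyMeasurable, ?_⟩
    rw [hasFiniteIntegral_iff_ofReal (Filter.Eventually.of_forall fun t => hH0 _)]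
    exact lt_top_iff_ne_top.2 htop
  obtain ⟨T, hT, hTΩ, hTb⟩ : ∃ T ∈ Icc (0 : ℝ) 1, (∀ t ∈ Ioo 0 T, γ t ∈ Ω) ∧
      v (γ T) ^ 2 ≤ v b ^ 2 := by
    by_cases hS : (Icc (0 : ℝ) 1 ∩ γ ⁻¹' Ωᶜ).Nonempty
    · obtain ⟨T, hT⟩ := (isCompact_Icc.inter_right
        (hΩ.isClosed_compl.preimage hγc)).exists_isLeast hS
      refine ⟨T, hT.1.1, fun t ht => ?_, ?_⟩
      · by_contra hcon
        exact absurd (hT.2 ⟨⟨ht.1.le, ht.2.le.trans hT.1.1.2⟩, hcon⟩) (not_le.2 ht.2)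
      · rw [hv, indicator_of_notMem hT.1.2, zero_pow two_ne_zero]
        exact sq_nonneg _
    · refine ⟨1, by simp, fun t ht => ?_, by simp [hγ]⟩
      by_contra hcon
      exact hS ⟨t, ⟨ht.1.le, ht.2.le⟩, hcon⟩
  have hintT : IntegrableOn (fun t => ‖b - a‖ * H (γ t)) (Icc 0 T) :=
    ((integrableOn_Icc_iff_integrableOn_Ioo).2 hint |>.mono_set
      (Icc_subset_Icc_right hT.2)).const_mul _
  have hftc := intervalIntegral.sub_le_integral_of_hasDeriv_right_of_le
    (g := fun t => -(v (γ t)) ^ 2)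
    (g' := fun t => -(2 * v (γ t) * fderiv ℝ u (γ t) (b - a))) hT.1
    (by fun_prop) (fun t ht => by
      have hu := ((hd _ (hTΩ t ht)).hasFDerivAt.congr_of_eventuallyEq
        (f₁ := v) (by
          filter_upwards [hΩ.mem_nhds (hTΩ t ht)] with x hx
          simp [hv, hx]))
      have hg : HasDerivAt γ (b - a) t := by
        simpa only [one_smul] using HasDerivAt.const_add a ((hasDerivAt_id' t).smul_const (b - a))
      refine HasDerivAt.hasDerivWithinAt ?_
      convert ((hu.comp_hasDerivAt t hg).pow 2).neg using 1
      · rfl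
      · norm_num) hintT (fun t ht => by
      rw [hHv]
      calc -(2 * v (γ t) * fderiv ℝ u (γ t) (b - a))
          ≤ |2 * v (γ t) * fderiv ℝ u (γ t) (b - a)| := neg_le_abs _
        _ = 2 * |v (γ t)| * ‖fderiv ℝ u (γ t) (b - a)‖ := by
            rw [abs_mul, abs_mul, abs_two, Real.norm_eq_abs]
        _ ≤ 2 * |v (γ t)| * (‖fderiv ℝ u (γ t)‖ * ‖b - a‖) := by
            gcongr
            exact ContinuousLinearMap.le_opNorm _ _
        _ = ‖b - a‖ * (2 * |v (γ t)| * ‖fderiv ℝ u (γ t)‖) := by ring)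
  have hle : ∫ t in (0 : ℝ)..T, ‖b - a‖ * H (γ t) ≤ ‖b - a‖ * ∫ t in Ioo (0 : ℝ) 1, H (γ t) := by
    rw [intervalIntegral.integral_const_mul, intervalIntegral.integral_of_le hT.1,
      integral_Ioc_eq_integral_Ioo]
    refine mul_le_mul_of_nonneg_left ?_ (norm_nonneg _)
    exact setIntegral_mono_set hint (Filter.Eventually.of_forall fun t => hH0 _)
      (Ioo_subset_Ioo_right hT.2).eventuallyLE
  have ha : γ 0 = a := by simp [hγ]
  have hfinal : v a ^ 2 ≤ v b ^ 2 + ‖b - a‖ * ∫ t in Ioo (0 : ℝ) 1, H (γ t) := by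
    simp only [ha] at hftc
    linarith
  refine (ENNReal.ofReal_le_ofReal hfinal).trans (ENNReal.ofReal_add_le.trans (le_of_eq ?_))
  rw [ENNReal.ofReal_mul (norm_nonneg _), ofReal_norm,
    ofReal_integral_eq_lintegral_ofReal hint (Filter.Eventually.of_forall fun t => hH0 _)]

theorem exists_measure_ball_le_of_isADR (n : ℕ) : ∃ N : ℝ, 1 ≤ N ∧
    ∀ (F : Set (EuclideanSpace ℝ (Fin n))) (CAR : ℝ), 0 ≤ CAR → MeasurableSet F → IsADR F CAR →
      ediam F ≠ 0 → ∀ y, ∀ r : ℝ, 0 < r →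
        μH[(n : ℝ) - 1].restrict F (ball y r) ≤ ENNReal.ofReal (N * CAR * r ^ (n - 1)) := by
  obtain ⟨t, -, htf, htc⟩ :=
    (isCompact_closedBall (0 : EuclideanSpace ℝ (Fin n)) 1).finite_cover_balls (e := 1 / 2) (by norm_num)
  lift t to Finset (EuclideanSpace ℝ (Fin n)) using htf
  refine ⟨2 ^ (n - 1) * (t.card + 1), ?_, fun F CAR hCAR hF hADR hdiam y r hr => ?_⟩
  · exact one_le_mul_of_one_le_of_one_le (one_le_pow₀ one_le_two) (by simp)
  rw [Measure.restrict_apply measurableSet_ball]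
  rcases (ball y r ∩ F).eq_empty_or_nonempty with hemp | ⟨q, hqy, hqF⟩
  · simp [hemp]
  by_cases h2r : ENNReal.ofReal (2 * r) ≤ ediam F
  · have hsub : ball y r ⊆ ball q (2 * r) := by
      refine ball_subset_ball' ?_
      rw [mem_ball, dist_comm] at hqy
      linarith
    refine (measure_mono (inter_subset_inter_left F hsub)).trans
      ((hADR q hqF _ (by positivity) h2r).2.trans (ENNReal.ofReal_le_ofReal ?_))
    rw [mul_pow]
    have h1 : 0 ≤ 2 ^ (n - 1) * CAR * r ^ (n - 1) := by positivity
    have h2 : 0 ≤ (t.card : ℝ) * (2 ^ (n - 1) * CAR * r ^ (n - 1)) := by positivity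
    linarith
  · push Not at h2r
    have hfin : ediam F ≠ ∞ := ne_top_of_lt h2r
    set D := (ediam F).toReal with hD
    have hD0 : 0 < D := ENNReal.toReal_pos hdiam hfin
    have hDe : ENNReal.ofReal D = ediam F := ENNReal.ofReal_toReal hfin
    have hDr : D ≤ 2 * r := by
      rw [← hDe] at h2r
      exact ((ENNReal.ofReal_lt_ofReal_iff (by positivity)).1 h2r).le
    have hcov : F ⊆ ⋃ c ∈ t, ball (q + D • c) (D / 2) ∩ F := by
      intro z hz
      have hzq : dist z q ≤ D := by
        have := edist_le_ediam_of_mem hz hqF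
        rw [← hDe, edist_dist] at this
        exact (ENNReal.ofReal_le_ofReal_iff hD0.le).1 this
      have hmem : D⁻¹ • (z - q) ∈ closedBall (0 : EuclideanSpace ℝ (Fin n)) 1 := by
        rw [mem_closedBall_zero_iff, norm_smul, norm_inv, Real.norm_of_nonneg hD0.le,
          ← dist_eq_norm, inv_mul_le_iff₀ hD0]
        simpa using hzq
      obtain ⟨c, hc, hzc⟩ := mem_iUnion₂.1 (htc hmem)
      refine mem_iUnion₂.2 ⟨c, hc, ?_, hz⟩
      have e : z - (q + D • c) = D • (D⁻¹ • (z - q) - c) := by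
        rw [smul_sub, smul_inv_smul₀ hD0.ne']
        abel
      rw [mem_ball, dist_eq_norm] at hzc ⊢
      rw [e, norm_smul, Real.norm_of_nonneg hD0.le]
      linarith [mul_lt_mul_of_pos_left hzc hD0]
    have hpiece : ∀ c ∈ t, μH[(n : ℝ) - 1] (ball (q + D • c) (D / 2) ∩ F) ≤
        ENNReal.ofReal (CAR * D ^ (n - 1)) := by
      intro c _
      rcases (ball (q + D • c) (D / 2) ∩ F).eq_empty_or_nonempty with hemp | ⟨p, hp, hpF⟩
      · simp [hemp]
      refine (measure_mono (inter_subset_inter_left F (ball_subset_ball' ?_))).trans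
        (hADR p hpF D hD0 hDe.le).2
      rw [mem_ball, dist_comm] at hp
      linarith
    calc μH[(n : ℝ) - 1] (ball y r ∩ F) ≤ μH[(n : ℝ) - 1] (⋃ c ∈ t, ball (q + D • c) (D / 2) ∩ F) :=
          measure_mono (inter_subset_right.trans hcov)
      _ ≤ ∑ c ∈ t, μH[(n : ℝ) - 1] (ball (q + D • c) (D / 2) ∩ F) := measure_biUnion_finset_le _ _
      _ ≤ ∑ c ∈ t, ENNReal.ofReal (CAR * D ^ (n - 1)) := Finset.sum_le_sum hpiece
      _ = ENNReal.ofReal (t.card * (CAR * D ^ (n - 1))) := by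
          rw [Finset.sum_const, nsmul_eq_mul, ENNReal.ofReal_mul (Nat.cast_nonneg _),
            ENNReal.ofReal_natCast]
      _ ≤ _ := by
          refine ENNReal.ofReal_le_ofReal ?_
          calc (t.card : ℝ) * (CAR * D ^ (n - 1)) ≤ (t.card + 1) * (CAR * (2 * r) ^ (n - 1)) := by
                gcongr
                linarith
            _ = _ := by rw [mul_pow]; ring

theorem setLIntegral_div_infDist_sq_le_of_isADR {m : ℕ} {N CAR : ℝ} (hCAR : 0 < CAR) (hN : 0 ≤ N)
    {F : Set (EuclideanSpace ℝ (Fin (m + 1)))} (hF : IsClosed F) (hne : F.Nonempty)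
    (hADR : IsADR F CAR)
    (hball : ∀ y, ∀ r : ℝ, 0 < r →
      μH[((m + 1 : ℕ) : ℝ) - 1].restrict F (ball y r) ≤ ENNReal.ofReal (N * CAR * r ^ m))
    {w h : EuclideanSpace ℝ (Fin (m + 1)) → ℝ≥0∞} (hh : Measurable h)
    (hseg : ∀ a b, w a ≤ w b + ‖b - a‖ₑ * ∫⁻ t in Ioo (0 : ℝ) 1, h (a + t • (b - a)))
    (hw0 : ∀ x ∈ F, w x = 0) (hh0 : ∀ x ∈ F, h x = 0) :
    ∫⁻ x in {x | 0 < infDist x F ∧ ENNReal.ofReal (infDist x F) ≤ ediam F},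
        w x * (ENNReal.ofReal (infDist x F) ^ 2)⁻¹ ≤
      ENNReal.ofReal (2 ^ (2 * m + 3) * (N * CAR) / CAR⁻¹) *
        ∫⁻ x, h x * (ENNReal.ofReal (infDist x F))⁻¹ := by
  set μ := μH[((m + 1 : ℕ) : ℝ) - 1].restrict F with hμ
  have : IsLocallyFiniteMeasure μ := ⟨fun x => ⟨ball x 1, ball_mem_nhds x one_pos,
    (hball x 1 one_pos).trans_lt ENNReal.ofReal_lt_top⟩⟩
  have hmem : ∀ᵐ z ∂μ, z ∈ F := ae_restrict_mem hF.measurableSet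
  refine setLIntegral_div_sq_le_of_measure_ball volume μ (by simp) hh hseg
    (hmem.mono hw0) (δ := fun x => infDist x F)
    (fun x => hmem.mono fun z hz => infDist_le_dist_of_mem hz) (fun x hx => hh0 x ?_)
    (inv_pos.2 hCAR) (by positivity) hball ?_ (fun x hx => hx.1) fun x hx => ?_
  · exact (hF.mem_iff_infDist_zero hne).2 (le_antisymm hx infDist_nonneg)
  · exact (measurableSet_lt measurable_const measurable_infDist).inter
      (measurableSet_le measurable_infDist.ennreal_ofReal measurable_const)
  · obtain ⟨q, hqF, hq⟩ := hF.exists_infDist_eq_dist hne x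
    refine (hADR q hqF _ hx.1 hx.2).1.trans ?_
    rw [hμ, Measure.restrict_apply measurableSet_ball]
    refine measure_mono (inter_subset_inter_left F (ball_subset_ball' ?_))
    rw [dist_comm q x, ← hq]
    linarith

theorem lintegral_div_infDist_sq_le_of_isADR {m : ℕ} (hm : 2 ≤ m) {N CAR : ℝ} (hCAR : 0 < CAR)
    (hN : 0 ≤ N) {F : Set (EuclideanSpace ℝ (Fin (m + 1)))} (hF : IsClosed F) (hne : F.Nonempty)
    (hADR : IsADR F CAR)
    (hball : ediam F ≠ 0 → ∀ y, ∀ r : ℝ, 0 < r →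
      μH[((m + 1 : ℕ) : ℝ) - 1].restrict F (ball y r) ≤ ENNReal.ofReal (N * CAR * r ^ m))
    {w h : EuclideanSpace ℝ (Fin (m + 1)) → ℝ≥0∞} (hw : Measurable w) (hh : Measurable h)
    (hseg : ∀ a b, w a ≤ w b + ‖b - a‖ₑ * ∫⁻ t in Ioo (0 : ℝ) 1, h (a + t • (b - a)))
    (hw0 : ∀ x ∈ F, w x = 0) (hh0 : ∀ x ∈ F, h x = 0)
    (hfin : ∫⁻ x, w x * (ENNReal.ofReal (infDist x F) ^ 2)⁻¹ ≠ ∞) :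
    ∫⁻ x, w x * (ENNReal.ofReal (infDist x F) ^ 2)⁻¹ ≤
      ENNReal.ofReal (2 ^ (2 * m + 3) * (N * CAR) / CAR⁻¹ + 8) *
        ∫⁻ x, h x * (ENNReal.ofReal (infDist x F))⁻¹ := by
  set H := ∫⁻ x, h x * (ENNReal.ofReal (infDist x F))⁻¹ with hH
  set s := {x | 0 < infDist x F ∧ ENNReal.ofReal (infDist x F) ≤ ediam F} with hs
  have hsm : MeasurableSet s := (measurableSet_lt measurable_const measurable_infDist).inter
      (measurableSet_le measurable_infDist.ennreal_ofReal measurable_const)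
  have hnear : ∫⁻ x in s, w x * (ENNReal.ofReal (infDist x F) ^ 2)⁻¹ ≤
      ENNReal.ofReal (2 ^ (2 * m + 3) * (N * CAR) / CAR⁻¹) * H := by
    by_cases hdiam : ediam F = 0
    · have : s = ∅ := by
        refine eq_empty_of_forall_notMem fun x hx => ?_
        have h1 := hx.2
        rw [hdiam, nonpos_iff_eq_zero, ENNReal.ofReal_eq_zero] at h1
        exact h1.not_gt hx.1
      simp [this]
    · exact setLIntegral_div_infDist_sq_le_of_isADR hCAR hN hF hne hADR (hball hdiam) hh hseg
        hw0 hh0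
  obtain ⟨q, hqF⟩ := id hne
  have hδq : ∀ x, ENNReal.ofReal (infDist x F) ≤ ‖x - q‖ₑ := fun x => by
    rw [← edist_eq_enorm_sub, edist_dist]
    exact ENNReal.ofReal_le_ofReal (infDist_le_dist_of_mem hqF)
  have hpole : ∫⁻ x, w x * (‖x - q‖ₑ ^ 2)⁻¹ ≤ 2 * H := by
    have hle : ∫⁻ x, w x * (‖x - q‖ₑ ^ 2)⁻¹ ≤
        ∫⁻ x, w x * (ENNReal.ofReal (infDist x F) ^ 2)⁻¹ :=
      lintegral_mono fun x => by gcongr; exact hδq x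
    refine (lintegral_div_enorm_sq_le volume (by simpa using hm) hw hh hseg q
      (ne_top_of_le_ne_top hfin hle)).trans ?_
    rw [hH]
    gcongr with x
    exact hδq x
  have hfar : ∫⁻ x in sᶜ, w x * (ENNReal.ofReal (infDist x F) ^ 2)⁻¹ ≤ 8 * H := by
    calc ∫⁻ x in sᶜ, w x * (ENNReal.ofReal (infDist x F) ^ 2)⁻¹
        ≤ ∫⁻ x in sᶜ, 4 * (w x * (‖x - q‖ₑ ^ 2)⁻¹) := by
          refine setLIntegral_mono' hsm.compl fun x hx => ?_
          by_cases hxF : x ∈ F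
          · simp [hw0 x hxF]
          have hpos := (hF.notMem_iff_infDist_pos hne).1 hxF
          have hlt : ediam F < ENNReal.ofReal (infDist x F) := by
            by_contra hcon
            exact hx ⟨hpos, not_lt.1 hcon⟩
          have hle : ‖x - q‖ₑ ≤ 2 * ENNReal.ofReal (infDist x F) := by
            rw [← edist_eq_enorm_sub]
            refine (edist_le_infEDist_add_ediam hqF).trans ?_
            rw [two_mul, infDist, ENNReal.ofReal_toReal (infEDist_ne_top hne)] at *
            gcongr
          rw [mul_left_comm]
          gcongr
          rw [← div_eq_mul_inv]
          have h2 : ‖x - q‖ₑ ^ 2 ≤ 4 * ENNReal.ofReal (infDist x F) ^ 2 :=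
            (pow_le_pow_left' hle 2).trans (le_of_eq (by rw [mul_pow]; norm_num))
          have hD0 : ENNReal.ofReal (infDist x F) ^ 2 ≠ 0 := pow_ne_zero _ (by simpa using hpos)
          have hDt : ENNReal.ofReal (infDist x F) ^ 2 ≠ ∞ := ENNReal.pow_ne_top (by simp)
          have hxq : x ≠ q := fun e => hxF (e ▸ hqF)
          have hq0 : ‖x - q‖ₑ ^ 2 ≠ 0 := pow_ne_zero _ (by simpa [sub_eq_zero] using hxq)
          rw [ENNReal.le_div_iff_mul_le (Or.inl hq0) (Or.inl (by simp)), mul_comm,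
            ← div_eq_mul_inv, ENNReal.div_le_iff hD0 hDt]
          exact h2
      _ ≤ ∫⁻ x, 4 * (w x * (‖x - q‖ₑ ^ 2)⁻¹) := setLIntegral_le_lintegral _ _
      _ = 4 * ∫⁻ x, w x * (‖x - q‖ₑ ^ 2)⁻¹ := lintegral_const_mul' _ _ (by simp)
      _ ≤ 4 * (2 * H) := by gcongr
      _ = 8 * H := by rw [← mul_assoc]; norm_num
  rw [← lintegral_add_compl _ hsm, ENNReal.ofReal_add (by positivity) (by norm_num), add_mul]
  refine add_le_add hnear ?_
  simpa using hfar

theorem norm_gradient_eq {E : Type*} [NormedAddCommGroup E] [InnerProductSpace ℝ E]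
    [CompleteSpace E] (u : E → ℝ) (x : E) : ‖gradient u x‖ = ‖fderiv ℝ u x‖ := by
  simp [gradient]

/-- Global Hardy inequality on open sets with Ahlfors–David regular boundary. -/
theorem global_hardy_inequality (n : ℕ) (hn : 3 ≤ n) (CAR : ℝ) (hCAR : 1 < CAR) :
    ∃ C : ℝ, 0 < C ∧
      ∀ (Ω : Set (EuclideanSpace ℝ (Fin n))), IsOpen Ω → Ω.Nonempty →
        IsADR (frontier Ω) CAR →
        ∀ u : EuclideanSpace ℝ (Fin n) → ℝ,
          ContinuousOn u (closure Ω) →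
          (∀ x ∈ Ω, DifferentiableAt ℝ u x) →
          IntegrableOn (fun x => (u x) ^ 2) Ω volume →
          IntegrableOn (fun x => ‖gradient u x‖ ^ 2) Ω volume →
          (∀ x ∈ frontier Ω, u x = 0) →
          ∫ x in Ω, (u x / bdryDist Ω x) ^ 2 ≤ C * ∫ x in Ω, ‖gradient u x‖ ^ 2 := by
  obtain ⟨m, rfl⟩ : ∃ m, n = m + 1 := ⟨n - 1, by omega⟩
  obtain ⟨N, hN, hball⟩ := exists_measure_ball_le_of_isADR (m + 1)
  have hCAR0 : 0 < CAR := by linarith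
  set C := 2 ^ (2 * m + 3) * (N * CAR) / CAR⁻¹ + 8 with hC
  have hC0 : 0 < C := by positivity
  refine ⟨4 * C ^ 2, by positivity, fun Ω hΩ _ hADR u hc hd _ hgi h0 => ?_⟩
  set F := frontier Ω with hF
  rcases F.eq_empty_or_nonempty with hFe | hne
  · simp only [bdryDist, ← hF, hFe, infDist_empty, div_zero, ne_eq, OfNat.ofNat_ne_zero,
      not_false_eq_true, zero_pow, integral_zero]
    positivity
  by_cases hint : IntegrableOn (fun x => (u x / bdryDist Ω x) ^ 2) Ω
  swap
  · rw [integral_undef hint]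
    positivity
  have hFcl : IsClosed F := isClosed_frontier
  have hFΩ : ∀ x ∈ F, x ∉ Ω := fun x hx hxΩ => by
    rw [hF, hΩ.frontier_eq] at hx
    exact hx.2 hxΩ
  have hpos : ∀ x ∈ Ω, 0 < infDist x F := fun x hx =>
    (hFcl.notMem_iff_infDist_pos hne).1 fun hxF => hFΩ x hxF hx
  set w := Ω.indicator (fun x => ENNReal.ofReal (u x ^ 2)) with hw
  set h := Ω.indicator (fun x => ENNReal.ofReal (2 * |u x| * ‖fderiv ℝ u x‖)) with hh
  have hvm : Measurable (Ω.indicator u) := (continuous_indicator h0 hc).measurable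
  have hwm : Measurable w := by
    have : w = fun x => ENNReal.ofReal (Ω.indicator u x ^ 2) := by
      ext x
      by_cases hx : x ∈ Ω <;> simp [hw, hx]
    rw [this]
    fun_prop
  have hhm : Measurable h := by
    have : h = fun x => ENNReal.ofReal (2 * |Ω.indicator u x| * ‖fderiv ℝ u x‖) := by
      ext x
      by_cases hx : x ∈ Ω <;> simp [hh, hx]
    rw [this]
    exact ((measurable_const.mul hvm.abs).mul (measurable_fderiv ℝ u).norm).ennreal_ofReal
  have hwA : ∀ x, w x * (ENNReal.ofReal (infDist x F) ^ 2)⁻¹ =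
      Ω.indicator (fun x => ENNReal.ofReal ((u x / bdryDist Ω x) ^ 2)) x := by
    intro x
    by_cases hx : x ∈ Ω
    · have := hpos x hx
      rw [hw, indicator_of_mem hx, indicator_of_mem hx, div_pow,
        ENNReal.ofReal_div_of_pos (by rw [bdryDist]; positivity), div_eq_mul_inv, bdryDist,
        ENNReal.ofReal_pow this.le]
    · simp [hw, hx]
  have hA : ∫⁻ x, w x * (ENNReal.ofReal (infDist x F) ^ 2)⁻¹ =
      ENNReal.ofReal (∫ x in Ω, (u x / bdryDist Ω x) ^ 2) := by
    simp_rw [hwA]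
    rw [lintegral_indicator hΩ.measurableSet, ofReal_integral_eq_lintegral_ofReal hint
      (Filter.Eventually.of_forall fun x => sq_nonneg _)]
  have key := lintegral_div_infDist_sq_le_of_isADR (by omega) hCAR0 (by linarith) hFcl hne hADR
    (hball F CAR hCAR0.le hFcl.measurableSet hADR) hwm hhm
    (indicator_sq_le_add_lintegral_segment hΩ hc hd h0)
    (fun x hx => indicator_of_notMem (hFΩ x hx) _) (fun x hx => indicator_of_notMem (hFΩ x hx) _)
    (by rw [hA]; exact ENNReal.ofReal_ne_top)
  have hint2 : IntegrableOn (fun x => 2⁻¹ * (u x / bdryDist Ω x) ^ 2 +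
      2 * C ^ 2 * ‖gradient u x‖ ^ 2) Ω := (hint.const_mul _).add (hgi.const_mul _)
  have hyoung : ENNReal.ofReal C * ∫⁻ x, h x * (ENNReal.ofReal (infDist x F))⁻¹ ≤
      ENNReal.ofReal (2⁻¹ * (∫ x in Ω, (u x / bdryDist Ω x) ^ 2) +
        2 * C ^ 2 * ∫ x in Ω, ‖gradient u x‖ ^ 2) := by
    rw [← integral_const_mul, ← integral_const_mul,
      ← integral_add (hint.const_mul _) (hgi.const_mul _),
      ofReal_integral_eq_lintegral_ofReal hint2 (Filter.Eventually.of_forall fun x => by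
        dsimp only [Pi.zero_apply]; positivity),
      ← lintegral_indicator hΩ.measurableSet, ← lintegral_const_mul' _ _ ENNReal.ofReal_ne_top]
    refine lintegral_mono fun x => ?_
    by_cases hx : x ∈ Ω
    · have hδ := hpos x hx
      rw [hh, indicator_of_mem hx, indicator_of_mem hx, ← ENNReal.ofReal_inv_of_pos hδ,
        ← ENNReal.ofReal_mul (by positivity), ← ENNReal.ofReal_mul hC0.le, norm_gradient_eq]
      refine ENNReal.ofReal_le_ofReal ?_
      rw [bdryDist, ← sq_abs (u x / infDist x (frontier Ω)), abs_div, abs_of_pos hδ]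
      have hsq := sq_nonneg (|u x| / infDist x F - 2 * C * ‖fderiv ℝ u x‖)
      have e : C * (2 * |u x| * ‖fderiv ℝ u x‖ * (infDist x F)⁻¹) =
          2 * C * (|u x| / infDist x F) * ‖fderiv ℝ u x‖ := by
        rw [div_eq_mul_inv]; ring
      rw [e]
      nlinarith
    · simp [hh, hx]
  have hfinal := key.trans hyoung
  rw [hA, ENNReal.ofReal_le_ofReal_iff (by positivity)] at hfinal
  linarith
end
end

section
/- Let n ≥ 3 and let Ω ⊂ ℝⁿ be an open set (not necessarily bounded) whose boundary ∂Ω is (n−1)-dimensional Ahlfors–David regular with constant C_AR. Then there exist constants C ≥ 1 and K ≥ 1 depending only on n and C_AR such that for every q ∈ ∂Ω, every 0 < r ≤ diam ∂Ω, and every u ∈ W^{1,2}(Ω) ∩ C(Ω̄) with u = 0 on ∂Ω, one has the local Hardy inequality ∫_{Ω ∩ B(q,r)} (u(x)/δ(x))² dx ≤ C ∫_{Ω ∩ B(q,Kr)} |∇u(x)|² dx. (This is the ball formulation of the paper's Theorem 3.1: for every dyadic boundary cube Q₀ there is an enlarged cube Q̄₀ ⊇ Q₀ of comparable generation with ∫_{T_{Q₀}}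 (u/δ)² ≲ ∫_{T_{Q̄₀}} |∇u|², where T_Q denotes the Carleson box over Q.) -/
open MeasureTheory Metric Set

noncomputable section

/-- The real power `t ^ p` as an extended nonnegative number. -/
def pw (t p : ℝ) : ENNReal := ENNReal.ofReal (t ^ p)

lemma pw_ne_top (t p : ℝ) : pw t p ≠ ⊤ := ENNReal.ofReal_ne_top

lemma pw_pos {t : ℝ} (ht : 0 < t) (p : ℝ) : 0 < pw t p :=
  ENNReal.ofReal_pos.2 (Real.rpow_pos_of_pos ht p)

lemma pw_add {t : ℝ} (ht : 0 < t) (p q : ℝ) : pw t (p + q) = pw t p * pw t q := by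
  unfold pw
  rw [Real.rpow_add ht, ENNReal.ofReal_mul (Real.rpow_nonneg ht.le p)]

lemma pw_zero (t : ℝ) : pw t 0 = 1 := by simp [pw]

lemma pw_one (t : ℝ) : pw t 1 = ENNReal.ofReal t := by simp [pw]

lemma pw_natCast (t : ℝ) (k : ℕ) : pw t k = ENNReal.ofReal (t ^ k) := by simp [pw]

lemma mul_pw {s t : ℝ} (hs : 0 ≤ s) (ht : 0 ≤ t) (p : ℝ) : pw (s * t) p = pw s p * pw t p := by
  unfold pw
  rw [Real.mul_rpow hs ht, ENNReal.ofReal_mul (Real.rpow_nonneg hs p)]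

lemma pw_pow {t : ℝ} (ht : 0 ≤ t) (k : ℕ) (p : ℝ) : pw (t ^ k) p = pw t p ^ k := by
  unfold pw
  rw [← ENNReal.ofReal_pow (Real.rpow_nonneg ht p), ← Real.rpow_natCast, ← Real.rpow_natCast,
    ← Real.rpow_mul ht, ← Real.rpow_mul ht, mul_comm]

lemma pw_le_pw_of_nonneg {s t p : ℝ} (hs : 0 ≤ s) (hst : s ≤ t) (hp : 0 ≤ p) : pw s p ≤ pw t p :=
  ENNReal.ofReal_le_ofReal (Real.rpow_le_rpow hs hst hp)

lemma pw_le_pw_of_nonpos {s t p : ℝ} (hs : 0 < s) (hst : s ≤ t) (hp : p ≤ 0) : pw t p ≤ pw s p :=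
  ENNReal.ofReal_le_ofReal (Real.rpow_le_rpow_of_nonpos hs hst hp)

lemma pw_zero_left {p : ℝ} (hp : p ≠ 0) : pw 0 p = 0 := by simp [pw, Real.zero_rpow hp]

lemma pw_mul_pw_neg {t : ℝ} (ht : 0 < t) (p : ℝ) : pw t p * pw t (-p) = 1 := by
  rw [← pw_add ht, add_neg_cancel, pw_zero]

@[fun_prop]
lemma Measurable.pw {α : Type*} [MeasurableSpace α] {f : α → ℝ} (hf : Measurable f) (p : ℝ) :
    Measurable fun a => pw (f a) p :=
  (hf.pow_const p).ennreal_ofReal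

section Dyadic

variable {X : Type*} [PseudoMetricSpace X] [MeasurableSpace X] [OpensMeasurableSpace X]

/-- Riesz potentials of measures with polynomial growth, over a set covered by the
annuli `b R θ ^ k ≤ dist y z < a R θ ^ k`. -/
lemma setLIntegral_pw_dist_le {μ : Measure X} {z : X} {A : ENNReal} {m p a b θ R : ℝ} {S : Set X}
    (hS : MeasurableSet S) (hp : 0 < p) (ha : 0 < a) (hb : 0 < b) (hθ : 0 < θ) (hR : 0 < R)
    (hμ : ∀ ρ, 0 < ρ → μ (ball z ρ) ≤ A * pw ρ m)
    (hcov : ∀ y ∈ S, 0 < dist y z → ∃ k : ℕ, b * R * θ ^ k ≤ dist y z ∧ dist y z < a * R * θ ^ k) :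
    ∫⁻ y in S, pw (dist y z) (-p) ∂μ
      ≤ pw b (-p) * pw a m * (1 - pw θ (m - p))⁻¹ * A * pw R (m - p) := by
  calc ∫⁻ y in S, pw (dist y z) (-p) ∂μ
      ≤ ∫⁻ y in S, ∑' k : ℕ, (ball z (a * R * θ ^ k)).indicator
          (fun _ => pw (b * R * θ ^ k) (-p)) y ∂μ := by
        refine setLIntegral_mono' hS fun y hy => ?_
        rcases (dist_nonneg (x := y) (y := z)).eq_or_lt with h0 | h0
        · rw [← h0, pw_zero_left (by linarith)]
          exact zero_le
        · obtain ⟨k, hk1, hk2⟩ := hcov y hy h0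
          refine le_trans ?_ (ENNReal.le_tsum k)
          rw [indicator_of_mem (mem_ball.2 hk2)]
          exact pw_le_pw_of_nonpos (by positivity) hk1 (by linarith)
    _ ≤ ∫⁻ y, ∑' k : ℕ, (ball z (a * R * θ ^ k)).indicator
          (fun _ => pw (b * R * θ ^ k) (-p)) y ∂μ := setLIntegral_le_lintegral _ _
    _ = ∑' k : ℕ, pw (b * R * θ ^ k) (-p) * μ (ball z (a * R * θ ^ k)) := by
        rw [lintegral_tsum fun k =>
          (measurable_const.indicator measurableSet_ball).aemeasurable]
        simp_rw [lintegral_indicator measurableSet_ball, setLIntegral_const]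
    _ ≤ ∑' k : ℕ, pw b (-p) * pw a m * A * pw R (m - p) * pw θ (m - p) ^ k := by
        refine ENNReal.tsum_le_tsum fun k => ?_
        refine (mul_le_mul_right (hμ _ (by positivity)) _).trans (le_of_eq ?_)
        rw [mul_pw (by positivity) (by positivity), mul_pw hb.le hR.le,
          mul_pw (by positivity) (by positivity), mul_pw ha.le hR.le, ← pw_pow hθ.le,
          sub_eq_add_neg m p, pw_add hR, pw_add (by positivity : 0 < θ ^ k)]
        ring
    _ = _ := by
        rw [ENNReal.tsum_mul_left, ENNReal.tsum_geometric]
        ring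

lemma exists_setLIntegral_ball_pw_dist_le (X : Type*) [PseudoMetricSpace X] [MeasurableSpace X]
    [OpensMeasurableSpace X] {m p : ℝ} (hp : 0 < p) (hpm : p < m) :
    ∃ C : ENNReal, C ≠ ⊤ ∧ ∀ (μ : Measure X) (z : X) (A : ENNReal) (R : ℝ), 0 < R →
      (∀ ρ, 0 < ρ → μ (ball z ρ) ≤ A * pw ρ m) →
      ∫⁻ y in ball z R, pw (dist y z) (-p) ∂μ ≤ C * A * pw R (m - p) := by
  refine ⟨pw (1 / 2) (-p) * pw 2 m * (1 - pw (1 / 2) (m - p))⁻¹, ?_, fun μ z A R hR hμ =>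
    setLIntegral_pw_dist_le measurableSet_ball hp (by norm_num) (by norm_num) (by norm_num) hR hμ
      fun y hy h0 => ?_⟩
  · refine ENNReal.mul_ne_top (ENNReal.mul_ne_top (pw_ne_top _ _) (pw_ne_top _ _)) ?_
    rw [ENNReal.inv_ne_top]
    refine (tsub_pos_of_lt ?_).ne'
    rw [pw, ENNReal.ofReal_lt_one]
    exact Real.rpow_lt_one (by norm_num) (by norm_num) (by linarith)
  · rw [mem_ball] at hy
    obtain ⟨k, hk1, hk2⟩ := exists_nat_pow_near (x := R / dist y z) (y := (2 : ℝ))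
      ((one_le_div h0).2 hy.le) (by norm_num)
    rw [le_div_iff₀ h0] at hk1
    rw [div_lt_iff₀ h0] at hk2
    have h2 : (0 : ℝ) < 2 ^ k := by positivity
    refine ⟨k, ?_, ?_⟩
    · rw [one_div_pow, mul_one_div, div_le_iff₀ h2]
      rw [pow_succ] at hk2
      nlinarith
    · rw [one_div_pow, mul_one_div, lt_div_iff₀ h2]
      nlinarith

lemma exists_setLIntegral_compl_ball_pw_dist_le (X : Type*) [PseudoMetricSpace X]
    [MeasurableSpace X] [OpensMeasurableSpace X] {m p : ℝ} (hp : 0 < p) (hmp : m < p) :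
    ∃ C : ENNReal, C ≠ ⊤ ∧ ∀ (μ : Measure X) (z : X) (A : ENNReal) (R : ℝ), 0 < R →
      (∀ ρ, 0 < ρ → μ (ball z ρ) ≤ A * pw ρ m) →
      ∫⁻ y in (ball z R)ᶜ, pw (dist y z) (-p) ∂μ ≤ C * A * pw R (m - p) := by
  refine ⟨pw 1 (-p) * pw 2 m * (1 - pw 2 (m - p))⁻¹, ?_, fun μ z A R hR hμ =>
    setLIntegral_pw_dist_le measurableSet_ball.compl hp (by norm_num) (by norm_num) (by norm_num)
      hR hμ fun y hy h0 => ?_⟩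
  · refine ENNReal.mul_ne_top (ENNReal.mul_ne_top (pw_ne_top _ _) (pw_ne_top _ _)) ?_
    rw [ENNReal.inv_ne_top]
    refine (tsub_pos_of_lt ?_).ne'
    rw [pw, ENNReal.ofReal_lt_one]
    exact Real.rpow_lt_one_of_one_lt_of_neg (by norm_num) (by linarith)
  · rw [mem_compl_iff, mem_ball, not_lt] at hy
    obtain ⟨k, hk1, hk2⟩ := exists_nat_pow_near (x := dist y z / R) (y := (2 : ℝ))
      ((one_le_div hR).2 hy) (by norm_num)
    rw [le_div_iff₀ hR] at hk1
    rw [div_lt_iff₀ hR, pow_succ] at hk2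
    exact ⟨k, by linarith, by linarith⟩

end Dyadic

lemma enorm_sub_le_lintegral_deriv {f : ℝ → ℝ} {a b : ℝ} (hab : a ≤ b)
    (hf : ContinuousOn f (Icc a b)) (hd : ∀ t ∈ Ioo a b, DifferentiableAt ℝ f t) :
    ‖f b - f a‖ₑ ≤ ∫⁻ t in Ioo a b, ‖deriv f t‖ₑ := by
  by_cases hfin : ∫⁻ t in Ioo a b, ‖deriv f t‖ₑ = ⊤
  · rw [hfin]; exact le_top
  have hint : IntegrableOn (deriv f) (Ioo a b) :=
    ⟨(measurable_deriv f).aestronglyMeasurable, lt_top_iff_ne_top.2 hfin⟩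
  have h := intervalIntegral.integral_eq_sub_of_hasDerivAt_of_le hab hf
    (fun t ht => (hd t ht).hasDerivAt)
    ((intervalIntegrable_iff_integrableOn_Ioo_of_le hab).2 hint)
  rw [← h, intervalIntegral.integral_of_le hab, integral_Ioc_eq_integral_Ioo]
  exact enorm_integral_le_lintegral_enorm _

lemma enorm_sub_le_lintegral_of_eq_zero_off {f : ℝ → ℝ} {U : Set ℝ} {h : ℝ → ENNReal}
    (hf : Continuous f) (hU : IsOpen U) (h0 : ∀ t ∉ U, f t = 0)
    (hd : ∀ t ∈ U, DifferentiableAt ℝ f t) (hh : ∀ t ∈ U, ‖deriv f t‖ₑ ≤ h t) :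
    ‖f 1 - f 0‖ₑ ≤ ∫⁻ t in Ioo (0 : ℝ) 1, h t := by
  have key : ∀ a b : ℝ, a ≤ b → Ioo a b ⊆ U → ‖f b - f a‖ₑ ≤ ∫⁻ t in Ioo a b, h t := by
    intro a b hab hsub
    exact (enorm_sub_le_lintegral_deriv hab hf.continuousOn fun t ht => hd t (hsub ht)).trans
      (setLIntegral_mono' measurableSet_Ioo fun t ht => hh t (hsub ht))
  rcases (Icc (0 : ℝ) 1 \ U).eq_empty_or_nonempty with hS | hS
  · exact key 0 1 zero_le_one (Ioo_subset_Icc_self.trans (sdiff_eq_empty.1 hS))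
  have hcpt : IsCompact (Icc (0 : ℝ) 1 \ U) := isCompact_Icc.diff hU
  obtain ⟨a, ⟨haI, haU⟩, ha⟩ := hcpt.exists_isLeast hS
  obtain ⟨b, ⟨hbI, hbU⟩, hb⟩ := hcpt.exists_isGreatest hS
  have hab : a ≤ b := ha ⟨hbI, hbU⟩
  have h1 : Ioo 0 a ⊆ U := fun t ht => by
    by_contra hn
    exact ht.2.not_ge (ha ⟨⟨ht.1.le, ht.2.le.trans haI.2⟩, hn⟩)
  have h2 : Ioo b 1 ⊆ U := fun t ht => by
    by_contra hn
    exact ht.1.not_ge (hb ⟨⟨hbI.1.trans ht.1.le, ht.2.le⟩, hn⟩)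
  calc ‖f 1 - f 0‖ₑ = ‖(f a - f 0) + (f 1 - f b)‖ₑ := by
        rw [h0 a haU, h0 b hbU]; congr 1; ring
    _ ≤ ‖f a - f 0‖ₑ + ‖f 1 - f b‖ₑ := enorm_add_le _ _
    _ ≤ (∫⁻ t in Ioo 0 a, h t) + ∫⁻ t in Ioo b 1, h t :=
        add_le_add (key 0 a haI.1 h1) (key b 1 hbI.2 h2)
    _ = ∫⁻ t in Ioo 0 a ∪ Ioo b 1, h t := by
        rw [lintegral_union measurableSet_Ioo]
        exact Set.disjoint_left.2 fun t ht ht' => (ht.2.trans_le hab).not_gt ht'.1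
    _ ≤ ∫⁻ t in Ioo (0 : ℝ) 1, h t :=
        lintegral_mono_set (union_subset (Ioo_subset_Ioo_right haI.2) (Ioo_subset_Ioo_left hbI.1))

section Line

variable {E : Type*} [NormedAddCommGroup E] [NormedSpace ℝ E]

lemma enorm_indicator_sub_le_lintegral_fderiv {Ω : Set E} {u : E → ℝ} (hΩ : IsOpen Ω)
    (hc : ContinuousOn u (closure Ω)) (hd : ∀ x ∈ Ω, DifferentiableAt ℝ u x)
    (h0 : ∀ x ∈ frontier Ω, u x = 0) (x w : E) :
    ‖Ω.indicator u w - Ω.indicator u x‖ₑ ≤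
      ∫⁻ t in Ioo (0 : ℝ) 1, Ω.indicator (fun z => ‖fderiv ℝ u z‖ₑ) (x + t • (w - x)) *
        ‖w - x‖ₑ := by
  set γ : ℝ → E := fun t => x + t • (w - x) with hγ
  have hγc : Continuous γ := by fun_prop
  have hγd : ∀ t, HasDerivAt γ (w - x) t := fun t => by
    have h := ((hasDerivAt_id t).smul_const (w - x)).const_add x
    rw [one_smul] at h
    exact h
  have hder : ∀ t ∈ γ ⁻¹' Ω,
      HasDerivAt (fun s => Ω.indicator u (γ s)) (fderiv ℝ u (γ t) (w - x)) t := by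
    intro t ht
    have h1 : HasFDerivAt (Ω.indicator u) (fderiv ℝ u (γ t)) (γ t) :=
      (hd _ ht).hasFDerivAt.congr_of_eventuallyEq
        (Filter.eventuallyEq_of_mem (hΩ.mem_nhds ht) fun z hz => indicator_of_mem hz u)
    exact h1.comp_hasDerivAt t (hγd t)
  have := enorm_sub_le_lintegral_of_eq_zero_off (f := fun s => Ω.indicator u (γ s))
    (U := γ ⁻¹' Ω) (h := fun t => Ω.indicator (fun z => ‖fderiv ℝ u z‖ₑ) (γ t) * ‖w - x‖ₑ)
    ((continuous_indicator h0 hc).comp hγc) (hΩ.preimage hγc)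
    (fun t ht => indicator_of_notMem (show γ t ∉ Ω from ht) u) (fun t ht => (hder t ht).differentiableAt)
    (fun t ht => by
      rw [(hder t ht).deriv, indicator_of_mem (show γ t ∈ Ω from ht)]
      exact (fderiv ℝ u (γ t)).le_opENorm _)
  simpa [hγ] using this

variable [MeasurableSpace E] [BorelSpace E] [FiniteDimensional ℝ E]

lemma lintegral_comp_homothety_s1 (μ : Measure E) [μ.IsAddHaarMeasure] {f : E → ENNReal}
    (hf : Measurable f) (p : E) {t : ℝ} (ht : 0 < t) :
    ∫⁻ w, f (p + t • (w - p)) ∂μ = pw t (-(Module.finrank ℝ E : ℝ)) * ∫⁻ z, f z ∂μ := by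
  rw [lintegral_sub_right_eq_self (fun w => f (p + t • w)) p]
  have h1 : Measurable fun z => f (p + z) := hf.comp (measurable_const_add p)
  rw [← lintegral_map (f := fun z => f (p + z)) h1 (measurable_const_smul t),
    Measure.map_addHaar_smul μ ht.ne', lintegral_smul_measure, lintegral_add_left_eq_self f p,
    smul_eq_mul, abs_of_pos (by positivity), pw, Real.rpow_neg ht.le, Real.rpow_natCast]

lemma exists_lintegral_segment_le (μ : Measure E) [μ.IsAddHaarMeasure] :
    ∃ C : ENNReal, C ≠ ⊤ ∧ ∀ (g : E → ENNReal) (c p : E) (ρ : ℝ), Measurable g → p ∈ ball c ρ →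
      ∫⁻ w in ball c ρ, (∫⁻ t in Ioo (0 : ℝ) 1, g (p + t • (w - p)) * ‖w - p‖ₑ) ∂μ ≤
        C * pw ρ (Module.finrank ℝ E) *
          ∫⁻ z in ball c ρ, g z * pw (dist z p) (1 - Module.finrank ℝ E) ∂μ := by
  set N : ℝ := (Module.finrank ℝ E : ℝ) with hN
  have hN0 : 0 ≤ N := by positivity
  by_cases hN1 : N = 0
  · have : Module.finrank ℝ E = 0 := by exact_mod_cast hN ▸ hN1
    have := Module.finrank_zero_iff.1 this
    exact ⟨0, ENNReal.zero_ne_top, fun g c p ρ _ _ => by simp [Subsingleton.elim _ p]⟩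
  replace hN1 : 0 < N := lt_of_le_of_ne hN0 (Ne.symm hN1)
  obtain ⟨C, hC, hCb⟩ := exists_setLIntegral_compl_ball_pw_dist_le ℝ (m := 1) (p := N + 1)
    (by linarith) (by linarith)
  refine ⟨C * 2 * pw 2 N, ENNReal.mul_ne_top (ENNReal.mul_ne_top hC (by simp)) (pw_ne_top _ _),
    fun g c p ρ hg hp => ?_⟩
  have hρ : 0 < ρ := pos_of_mem_ball hp
  set G : E → ENNReal := fun z => (ball c ρ).indicator g z * ENNReal.ofReal (dist z p) with hG
  have hGm : Measurable G := (hg.indicator measurableSet_ball).mul (by fun_prop)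
  set χ : ℝ → E → ENNReal := fun t z => {y : ℝ × E | dist y.2 p < 2 * ρ * y.1}.indicator 1 (t, z)
    with hχ
  have hχm : Measurable (Function.uncurry χ) := by
    refine measurable_one.indicator (measurableSet_lt ?_ ?_) <;> fun_prop
  have hχm' : ∀ t, Measurable (χ t) := fun t => hχm.comp measurable_prodMk_left
  calc ∫⁻ w in ball c ρ, (∫⁻ t in Ioo (0 : ℝ) 1, g (p + t • (w - p)) * ‖w - p‖ₑ) ∂μ
      = ∫⁻ t in Ioo (0 : ℝ) 1, ∫⁻ w in ball c ρ, g (p + t • (w - p)) * ‖w - p‖ₑ ∂μ := by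
        apply lintegral_lintegral_swap
        refine Measurable.aemeasurable ?_
        unfold Function.uncurry
        fun_prop
    _ ≤ ∫⁻ t in Ioo (0 : ℝ) 1, ∫⁻ z, G z * (pw t (-(N + 1)) * χ t z) ∂μ := by
        refine setLIntegral_mono' measurableSet_Ioo fun t ht => ?_
        have e : ∫⁻ z, G z * (pw t (-(N + 1)) * χ t z) ∂μ =
            pw t (-N) * ∫⁻ z, G z * (pw t (-1) * χ t z) ∂μ := by
          rw [← lintegral_const_mul]
          · refine lintegral_congr fun z => ?_
            rw [neg_add, pw_add ht.1]
            ring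
          · exact hGm.mul ((hχm' t).const_mul _)
        have hom := lintegral_comp_homothety_s1 μ (f := fun z => G z * (pw t (-1) * χ t z))
          (hGm.mul ((hχm' t).const_mul _)) p ht.1
        rw [← hN] at hom
        rw [e, ← hom, ← lintegral_indicator measurableSet_ball]
        refine lintegral_mono fun w => ?_
        by_cases hw : w ∈ ball c ρ
        · rw [indicator_of_mem hw]
          have hd : dist (p + t • (w - p)) p = t * dist w p := by
            rw [dist_eq_norm, add_sub_cancel_left, norm_smul, Real.norm_of_nonneg ht.1.le,
              dist_eq_norm]
          have hmem : p + t • (w - p) ∈ ball c ρ :=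
            (convex_ball c ρ).add_smul_sub_mem hp hw ⟨ht.1.le, ht.2.le⟩
          have hdist : dist w p < 2 * ρ := by
            have := dist_triangle_right w p c
            rw [mem_ball] at hw hp
            linarith
          have hχ1 : χ t (p + t • (w - p)) = 1 := by
            refine indicator_of_mem (s := {y : ℝ × E | _}) (f := 1) ?_
            change dist (p + t • (w - p)) p < 2 * ρ * t
            rw [hd, mul_comm (2 * ρ)]
            exact mul_lt_mul_of_pos_left hdist ht.1
          simp only [hG]
          rw [hχ1, indicator_of_mem hmem, hd, mul_one, mul_assoc, ENNReal.ofReal_mul ht.1.le,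
            ← pw_one t]
          rw [show pw t 1 * ENNReal.ofReal (dist w p) * pw t (-1) =
            (pw t 1 * pw t (-1)) * ENNReal.ofReal (dist w p) by ring, pw_mul_pw_neg ht.1, one_mul,
            dist_eq_norm, ofReal_norm]
        · rw [indicator_of_notMem hw]
          exact zero_le
    _ = ∫⁻ z, (∫⁻ t in Ioo (0 : ℝ) 1, G z * (pw t (-(N + 1)) * χ t z)) ∂μ := by
        apply lintegral_lintegral_swap
        refine Measurable.aemeasurable ?_
        refine (hGm.comp measurable_snd).mul (Measurable.mul ?_ hχm)
        fun_prop
    _ ≤ ∫⁻ z, (ball c ρ).indicator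
          (fun z => C * 2 * pw 2 N * pw ρ N * (g z * pw (dist z p) (1 - N))) z ∂μ := by
        refine lintegral_mono fun z => ?_
        by_cases hz : z ∈ ball c ρ
        swap
        · simp [hG, hz]
        rw [indicator_of_mem hz]
        rcases (dist_nonneg (x := z) (y := p)).eq_or_lt with h0 | h0
        · simp [hG, ← h0]
        have hR : 0 < dist z p / (2 * ρ) := by positivity
        have hin : ∫⁻ t in Ioo (0 : ℝ) 1, pw t (-(N + 1)) * χ t z ≤
            C * 2 * pw (dist z p / (2 * ρ)) (1 - (N + 1)) := by
          refine le_trans ?_ (hCb volume 0 2 _ hR fun s hs => ?_)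
          · rw [← lintegral_indicator measurableSet_Ioo,
              ← lintegral_indicator measurableSet_ball.compl]
            refine lintegral_mono fun t => ?_
            by_cases ht : t ∈ Ioo (0 : ℝ) 1
            swap
            · rw [indicator_of_notMem ht]
              exact zero_le
            rw [indicator_of_mem ht]
            by_cases hχt : dist z p < 2 * ρ * t
            · have h1 : χ t z = 1 := indicator_of_mem (s := {y : ℝ × E | _}) hχt _
              have h2 : dist t 0 = t := by
                rw [Real.dist_eq, sub_zero, abs_of_pos ht.1]
              rw [h1, mul_one, indicator_of_mem, h2]
              rw [mem_compl_iff, mem_ball, h2, not_lt, div_le_iff₀ (by positivity)]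
              linarith
            · have h1 : χ t z = 0 := indicator_of_notMem (s := {y : ℝ × E | _}) hχt _
              rw [h1, mul_zero]
              exact zero_le
          · rw [Real.volume_ball, pw_one, ENNReal.ofReal_mul (by norm_num)]
            simp
        rw [lintegral_const_mul]
        swap
        · exact (measurable_id.pw _).mul (hχm.comp measurable_prodMk_right)
        refine (mul_le_mul_right hin _).trans (le_of_eq ?_)
        simp only [hG]
        rw [indicator_of_mem hz, ← pw_one, show (1 : ℝ) - (N + 1) = -N by ring, div_eq_mul_inv,
          mul_pw h0.le (by positivity), mul_inv, mul_pw (by positivity) (by positivity)]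
        have hinv : ∀ s : ℝ, 0 < s → pw s⁻¹ (-N) = pw s N := fun s hs => by
          rw [pw, pw, Real.inv_rpow hs.le, Real.rpow_neg hs.le, inv_inv]
        rw [hinv 2 (by norm_num), hinv ρ hρ, show 1 - N = 1 + -N by ring, pw_add h0]
        ring
    _ = C * 2 * pw 2 N * pw ρ N * ∫⁻ z in ball c ρ, g z * pw (dist z p) (1 - N) ∂μ := by
        rw [lintegral_indicator measurableSet_ball, lintegral_const_mul]
        exact hg.mul (by fun_prop)

end Line

lemma exists_finset_cover_of_dist_le {E : Type*} [NormedAddCommGroup E] [NormedSpace ℝ E]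
    [FiniteDimensional ℝ E] {F : Set E} {D : ℝ} (hD : 0 < D)
    (hF : ∀ x ∈ F, ∀ y ∈ F, dist x y ≤ D) :
    ∃ s : Finset E, ↑s ⊆ F ∧ s.card ≤ 5 ^ Module.finrank ℝ E ∧ F ⊆ ⋃ p ∈ s, ball p D := by
  classical
  rcases F.eq_empty_or_nonempty with rfl | ⟨z, hz⟩
  · exact ⟨∅, by simp⟩
  set P : Set (Finset E) := {s | ↑s ⊆ F ∧ ∀ x ∈ s, ∀ y ∈ s, x ≠ y → D ≤ dist x y} with hP
  have hcard : ∀ s ∈ P, s.card ≤ 5 ^ Module.finrank ℝ E := by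
    intro s hs
    have hinj : Function.Injective fun x : E => D⁻¹ • (x - z) := fun x y hxy => by
      simpa [hD.ne'] using hxy
    rw [← Finset.card_image_of_injective s hinj]
    refine Besicovitch.card_le_of_separated _ ?_ ?_
    · intro c hc
      obtain ⟨x, hx, rfl⟩ := Finset.mem_image.1 hc
      rw [norm_smul, norm_inv, Real.norm_of_nonneg hD.le, ← dist_eq_norm, inv_mul_le_iff₀ hD]
      linarith [hF x (hs.1 hx) z hz]
    · intro c hc d hd hcd
      obtain ⟨x, hx, rfl⟩ := Finset.mem_image.1 hc
      obtain ⟨y, hy, rfl⟩ := Finset.mem_image.1 hd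
      rw [← smul_sub, sub_sub_sub_cancel_right, norm_smul, norm_inv, Real.norm_of_nonneg hD.le,
        ← dist_eq_norm, le_inv_mul_iff₀ hD, mul_one]
      exact hs.2 x hx y hy fun h => hcd (by rw [h])
  have hbdd : BddAbove (Finset.card '' P) :=
    ⟨_, by rintro _ ⟨s, hs, rfl⟩; exact hcard s hs⟩
  obtain ⟨s, hs, hmax⟩ := Nat.sSup_mem (s := Finset.card '' P)
    ⟨0, ∅, by simp [hP], rfl⟩ hbdd
  refine ⟨s, hs.1, hcard s hs, fun y hy => ?_⟩
  by_contra hn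
  simp only [mem_iUnion, mem_ball, not_exists, not_lt] at hn
  have hys : y ∉ s := fun h => by
    have := hn y h
    rw [dist_self] at this
    linarith
  have hins : insert y s ∈ P := by
    refine ⟨?_, ?_⟩
    · rw [Finset.coe_insert]
      exact insert_subset hy hs.1
    · intro a ha b hb hab
      rcases Finset.mem_insert.1 ha with rfl | ha' <;> rcases Finset.mem_insert.1 hb with rfl | hb'
      · exact absurd rfl hab
      · exact hn b hb'
      · rw [dist_comm]; exact hn a ha'
      · exact hs.2 a ha' b hb' hab
  have := le_csSup hbdd ⟨_, hins, rfl⟩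
  rw [← hmax, Finset.card_insert_of_notMem hys] at this
  omega

lemma restrict_ball_le_of_ball_le {E : Type*} [NormedAddCommGroup E] [NormedSpace ℝ E]
    [FiniteDimensional ℝ E] [MeasurableSpace E] [BorelSpace E] {ν : Measure E} {F : Set E}
    {a : ENNReal} {m : ℝ} (hm : 0 ≤ m) (hdiam : Metric.ediam F ≠ 0)
    (h : ∀ q ∈ F, ∀ r : ℝ, 0 < r → ENNReal.ofReal r ≤ Metric.ediam F →
      ν (ball q r ∩ F) ≤ a * pw r m) (z : E) {ρ : ℝ} (hρ : 0 < ρ) :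
    ν.restrict F (ball z ρ) ≤ 5 ^ Module.finrank ℝ E * pw 2 m * a * pw ρ m := by
  have center : ∀ q ∈ F, ∀ r : ℝ, 0 < r →
      ν (ball q r ∩ F) ≤ 5 ^ Module.finrank ℝ E * (a * pw r m) := by
    intro q hq r hr
    rcases le_or_gt (ENNReal.ofReal r) (Metric.ediam F) with hle | hlt
    · refine (h q hq r hr hle).trans (le_mul_of_one_le_left zero_le (one_le_pow₀ (by norm_num)))
    · have hfin : Metric.ediam F ≠ ⊤ := hlt.ne_top
      set D := (Metric.ediam F).toReal with hDdef
      have hD : 0 < D := ENNReal.toReal_pos hdiam hfin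
      have hDof : ENNReal.ofReal D = Metric.ediam F := ENNReal.ofReal_toReal hfin
      have hDr : D ≤ r := by
        rw [← hDof] at hlt
        exact (ENNReal.ofReal_lt_ofReal_iff hr).1 hlt |>.le
      obtain ⟨s, hsF, hs, hcov⟩ := exists_finset_cover_of_dist_le (F := F) hD fun x hx y hy => by
        rw [← ENNReal.ofReal_le_ofReal_iff hD.le, hDof, ← edist_dist]
        exact Metric.edist_le_ediam_of_mem hx hy
      calc ν (ball q r ∩ F) ≤ ν (⋃ p ∈ s, ball p D ∩ F) := by
            refine measure_mono fun y hy => ?_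
            have := hcov hy.2
            simp only [mem_iUnion] at this ⊢
            obtain ⟨p, hp, hyp⟩ := this
            exact ⟨p, hp, hyp, hy.2⟩
        _ ≤ ∑ p ∈ s, ν (ball p D ∩ F) := measure_biUnion_finset_le s _
        _ ≤ ∑ p ∈ s, a * pw r m := Finset.sum_le_sum fun p hp =>
            (h p (hsF hp) D hD hDof.le).trans
              (mul_le_mul_right (pw_le_pw_of_nonneg hD.le hDr hm) _)
        _ = (s.card : ENNReal) * (a * pw r m) := by rw [Finset.sum_const, nsmul_eq_mul]
        _ ≤ _ := by
            refine mul_le_mul_left ?_ _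
            exact_mod_cast hs
  rw [Measure.restrict_apply measurableSet_ball]
  rcases (ball z ρ ∩ F).eq_empty_or_nonempty with he | ⟨y, hyz, hyF⟩
  · rw [he, measure_empty]
    exact zero_le
  · have hsub : ball z ρ ∩ F ⊆ ball y (2 * ρ) ∩ F :=
      inter_subset_inter_left _ (ball_subset_ball' (by
        rw [mem_ball, dist_comm] at hyz
        linarith))
    refine (measure_mono hsub).trans ((center y hyF (2 * ρ) (by positivity)).trans (le_of_eq ?_))
    rw [mul_pw (by norm_num) hρ.le]
    ring

lemma volume_ball_eq_mul_pw {E : Type*} [NormedAddCommGroup E] [NormedSpace ℝ E]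
    [FiniteDimensional ℝ E] [MeasurableSpace E] [BorelSpace E] [Nontrivial E] (μ : Measure E)
    [μ.IsAddHaarMeasure] (z : E) {ρ : ℝ} (hρ : 0 < ρ) :
    μ (ball z ρ) = μ (ball 0 1) * pw ρ (Module.finrank ℝ E) := by
  rw [Measure.addHaar_ball μ z hρ.le, pw_natCast, mul_comm]

section Potential

variable {E : Type*} [NormedAddCommGroup E] [NormedSpace ℝ E] [FiniteDimensional ℝ E]
  [MeasurableSpace E] [BorelSpace E]

lemma exists_setLIntegral_ball_pw_one_sub_le (E : Type*) [NormedAddCommGroup E] [NormedSpace ℝ E]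
    [MeasurableSpace E] [BorelSpace E] {N : ℝ} (hN : 1 ≤ N) :
    ∃ C : ENNReal, C ≠ ⊤ ∧ ∀ (σ : Measure E) (F : Set E) (z : E) (A : ENNReal) (R : ℝ),
      (∀ᵐ y ∂σ, y ∈ F) → (∀ ρ, 0 < ρ → σ (ball z ρ) ≤ A * pw ρ (N - 1)) → 0 < infDist z F →
      ∫⁻ y in ball z R, pw (dist y z) (1 - N) ∂σ ≤
        C * A * pw R (1 / 4) * pw (infDist z F) (-(1 / 4)) := by
  obtain ⟨C, hC, hCb⟩ := exists_setLIntegral_compl_ball_pw_dist_le E (m := N - 1)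
    (p := N - 1 + 1 / 4) (by linarith) (by linarith)
  refine ⟨C, hC, fun σ F z A R hF hA hδ => ?_⟩
  have key := hCb σ z A _ hδ hA
  rw [show N - 1 - (N - 1 + 1 / 4) = -(1 / 4) by ring] at key
  calc ∫⁻ y in ball z R, pw (dist y z) (1 - N) ∂σ
      ≤ ∫⁻ y in (ball z (infDist z F))ᶜ, pw R (1 / 4) * pw (dist y z) (-(N - 1 + 1 / 4)) ∂σ := by
        rw [← lintegral_indicator measurableSet_ball,
          ← lintegral_indicator measurableSet_ball.compl]
        refine lintegral_mono_ae ?_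
        filter_upwards [hF] with y hy
        by_cases hyR : y ∈ ball z R
        swap
        · rw [indicator_of_notMem hyR]; exact zero_le
        have hδy : infDist z F ≤ dist y z := by rw [dist_comm]; exact infDist_le_dist_of_mem hy
        have hpos : 0 < dist y z := hδ.trans_le hδy
        rw [indicator_of_mem hyR, indicator_of_mem (by simpa using hδy),
          show 1 - N = 1 / 4 + -(N - 1 + 1 / 4) by ring, pw_add hpos]
        exact mul_le_mul_left (pw_le_pw_of_nonneg hpos.le (mem_ball.1 hyR).le (by norm_num)) _
    _ = pw R (1 / 4) * ∫⁻ y in (ball z (infDist z F))ᶜ, pw (dist y z) (-(N - 1 + 1 / 4)) ∂σ :=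
        lintegral_const_mul _ (by fun_prop)
    _ ≤ pw R (1 / 4) * (C * A * pw (infDist z F) (-(1 / 4))) := mul_le_mul_right key _
    _ = _ := by ring

lemma exists_setLIntegral_pw_infDist_le [Nontrivial E] (μ : Measure E) [μ.IsAddHaarMeasure] :
    ∃ C : ENNReal, C ≠ ⊤ ∧ ∀ (σ : Measure E) (F : Set E) (x : E) (A c : ENNReal), SFinite σ →
      IsClosed F → F.Nonempty → 0 < infDist x F →
      (∀ z ρ, 0 < ρ → σ (ball z ρ) ≤ A * pw ρ (Module.finrank ℝ E - 1)) →
      (∀ y ∈ F, ∀ ρ, 0 < ρ → ρ ≤ infDist x F →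
        pw ρ (Module.finrank ℝ E - 1) ≤ c * σ (ball y ρ)) →
      ∫⁻ z in ball x (2 * infDist x F), pw (infDist z F) (-(3 / 4)) ∂μ ≤
        C * A * c * pw (infDist x F) (Module.finrank ℝ E - 3 / 4) := by
  set N : ℝ := (Module.finrank ℝ E : ℝ) with hN
  have hN1 : 1 ≤ N := by
    rw [hN]
    exact_mod_cast Module.finrank_pos (R := ℝ) (M := E)
  obtain ⟨C, hC, hCb⟩ := exists_setLIntegral_ball_pw_dist_le E (m := N) (p := N - 1 / 4)
    (by linarith) (by linarith)
  have hβ : μ (ball 0 1) ≠ ⊤ := measure_ball_lt_top.ne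
  refine ⟨pw 3 (N - 1) * pw 2 (N - 1 / 4) * (C * μ (ball 0 1) * pw 8 (1 / 4)) * pw 6 (N - 1),
    by simp only [ne_eq, ENNReal.mul_eq_top, pw_ne_top, hC, hβ]; simp,
    fun σ F x A c _ hFc hFn hd hU hL => ?_⟩
  set d := infDist x F with hdd
  calc ∫⁻ z in ball x (2 * d), pw (infDist z F) (-(3 / 4)) ∂μ
      ≤ ∫⁻ z in ball x (2 * d), pw 3 (N - 1) * pw 2 (N - 1 / 4) * c *
          (∫⁻ y in ball x (6 * d), pw (dist z y) (-(N - 1 / 4)) ∂σ) ∂μ := by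
        refine setLIntegral_mono' measurableSet_ball fun z hz => ?_
        rcases (infDist_nonneg (x := z) (s := F)).eq_or_lt with h0 | h0
        · rw [← h0, pw_zero_left (by norm_num)]
          exact zero_le
        obtain ⟨y', hy', hδ⟩ := hFc.exists_infDist_eq_dist hFn z
        set δ := infDist z F with hδd
        have hδ3 : δ ≤ 3 * d := by
          have h1 := infDist_le_infDist_add_dist (s := F) (x := z) (y := x)
          rw [mem_ball] at hz
          linarith
        calc pw δ (-(3 / 4)) = pw 3 (N - 1) * pw 2 (N - 1 / 4) *
              (pw (2 * δ) (-(N - 1 / 4)) * pw (δ / 3) (N - 1)) := by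
              rw [mul_pw (by norm_num) h0.le]
              have e1 : pw 3 (N - 1) * pw (δ / 3) (N - 1) = pw δ (N - 1) := by
                rw [← mul_pw (by norm_num) (by positivity)]
                congr 1; ring
              have e2 := pw_mul_pw_neg (t := 2) (by norm_num) (N - 1 / 4)
              calc pw δ (-(3 / 4)) = pw δ (N - 1) * pw δ (-(N - 1 / 4)) := by
                    rw [← pw_add h0]; congr 1; ring
                _ = (pw 3 (N - 1) * pw (δ / 3) (N - 1)) * pw δ (-(N - 1 / 4)) *
                    (pw 2 (N - 1 / 4) * pw 2 (-(N - 1 / 4))) := by rw [e1, e2, mul_one]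
                _ = _ := by ring
          _ ≤ pw 3 (N - 1) * pw 2 (N - 1 / 4) *
              (pw (2 * δ) (-(N - 1 / 4)) * (c * σ (ball y' (δ / 3)))) := by
              gcongr
              exact hL y' hy' _ (by positivity) (by linarith)
          _ = pw 3 (N - 1) * pw 2 (N - 1 / 4) * c *
              ∫⁻ y in ball y' (δ / 3), pw (2 * δ) (-(N - 1 / 4)) ∂σ := by
              rw [setLIntegral_const]; ring
          _ ≤ pw 3 (N - 1) * pw 2 (N - 1 / 4) * c *
              ∫⁻ y in ball y' (δ / 3), pw (dist z y) (-(N - 1 / 4)) ∂σ := by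
              refine mul_le_mul_right (setLIntegral_mono' measurableSet_ball fun y hy => ?_) _
              rw [mem_ball] at hy
              have h1 := dist_triangle z y y'
              have h2 := dist_triangle_right z y y'
              refine pw_le_pw_of_nonpos (by linarith) (by linarith) (by linarith)
          _ ≤ _ := by
              refine mul_le_mul_right (lintegral_mono_set (ball_subset_ball' ?_)) _
              have h1 := dist_triangle y' z x
              rw [mem_ball] at hz
              rw [dist_comm] at hδ
              linarith
    _ = pw 3 (N - 1) * pw 2 (N - 1 / 4) * c * ∫⁻ z in ball x (2 * d),
          (∫⁻ y in ball x (6 * d), pw (dist z y) (-(N - 1 / 4)) ∂σ) ∂μ := by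
        refine lintegral_const_mul _ (Measurable.lintegral_prod_right ?_)
        fun_prop
    _ = pw 3 (N - 1) * pw 2 (N - 1 / 4) * c * ∫⁻ y in ball x (6 * d),
          (∫⁻ z in ball x (2 * d), pw (dist z y) (-(N - 1 / 4)) ∂μ) ∂σ := by
        rw [lintegral_lintegral_swap]
        refine Measurable.aemeasurable ?_
        unfold Function.uncurry
        fun_prop
    _ ≤ pw 3 (N - 1) * pw 2 (N - 1 / 4) * c * ∫⁻ y in ball x (6 * d),
          C * μ (ball 0 1) * pw (8 * d) (1 / 4) ∂σ := by
        refine mul_le_mul_right (setLIntegral_mono' measurableSet_ball fun y hy => ?_) _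
        refine (lintegral_mono_set (ball_subset_ball' (ε₂ := 8 * d) ?_)).trans
          ((hCb μ y (μ (ball 0 1)) (8 * d) (by positivity) fun ρ hρ =>
            (volume_ball_eq_mul_pw μ y hρ).le).trans (le_of_eq ?_))
        · rw [mem_ball, dist_comm] at hy
          linarith
        · rw [sub_sub_cancel]
    _ ≤ pw 3 (N - 1) * pw 2 (N - 1 / 4) * c *
          (C * μ (ball 0 1) * pw (8 * d) (1 / 4) * (A * pw (6 * d) (N - 1))) := by
        rw [setLIntegral_const]
        gcongr
        exact hU x _ (by positivity)
    _ = _ := by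
        rw [mul_pw (by norm_num) hd.le, mul_pw (by norm_num) hd.le,
          show N - 3 / 4 = 1 / 4 + (N - 1) by ring, pw_add hd]
        ring

end Potential

lemma pw_sq {t : ℝ} (ht : 0 ≤ t) (p : ℝ) : pw t p ^ 2 = pw t (p * 2) := by
  rw [pw, pw, ← ENNReal.ofReal_pow (Real.rpow_nonneg ht p), ← Real.rpow_natCast,
    ← Real.rpow_mul ht, Nat.cast_ofNat]

lemma ENNReal.add_sq_le_four_mul (a b : ENNReal) : (a + b) ^ 2 ≤ 4 * (a ^ 2 + b ^ 2) := by
  wlog hab : a ≤ b generalizing a b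
  · rw [add_comm a b, add_comm (a ^ 2)]
    exact this b a (le_of_not_ge hab)
  calc (a + b) ^ 2 ≤ (b + b) ^ 2 := by gcongr
    _ = 4 * b ^ 2 := by ring
    _ ≤ 4 * (a ^ 2 + b ^ 2) := by gcongr; exact le_add_self

lemma sq_lintegral_mul_le {α : Type*} [MeasurableSpace α] {μ : Measure α} {f g : α → ENNReal}
    (hf : Measurable f) (hg : Measurable g) :
    (∫⁻ a, f a * g a ∂μ) ^ 2 ≤ (∫⁻ a, f a ^ 2 ∂μ) * ∫⁻ a, g a ^ 2 ∂μ := by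
  have h := ENNReal.lintegral_mul_le_Lp_mul_Lq μ Real.HolderConjugate.two_two
    hf.aemeasurable hg.aemeasurable
  simp only [Pi.mul_apply, ENNReal.rpow_two] at h
  refine (pow_le_pow_left' h 2).trans (le_of_eq ?_)
  have e : ∀ s : ENNReal, (s ^ (1 / 2 : ℝ)) ^ 2 = s := fun s => by
    rw [← ENNReal.rpow_natCast, ← ENNReal.rpow_mul]
    norm_num
  rw [mul_pow, e, e]

section Potential

variable {E : Type*} [NormedAddCommGroup E] [NormedSpace ℝ E] [FiniteDimensional ℝ E]
  [MeasurableSpace E] [BorelSpace E]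

lemma exists_enorm_le_two_riesz [Nontrivial E] (μ : Measure E) [μ.IsAddHaarMeasure] :
    ∃ C : ENNReal, C ≠ ⊤ ∧ ∀ (v : E → ℝ) (g : E → ENNReal) (c x y : E) (ρ : ℝ), Measurable g →
      (∀ p w, ‖v w - v p‖ₑ ≤ ∫⁻ t in Ioo (0 : ℝ) 1, g (p + t • (w - p)) * ‖w - p‖ₑ) →
      x ∈ ball c ρ → y ∈ ball c ρ →
      ‖v x - v y‖ₑ ≤ C * (∫⁻ z in ball c ρ, g z * pw (dist z x) (1 - Module.finrank ℝ E) ∂μ +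
        ∫⁻ z in ball c ρ, g z * pw (dist z y) (1 - Module.finrank ℝ E) ∂μ) := by
  obtain ⟨C, hC, hCb⟩ := exists_lintegral_segment_le μ
  have hβ : μ (ball 0 1) ≠ ⊤ := measure_ball_lt_top.ne
  have hβ0 : μ (ball 0 1) ≠ 0 := (measure_ball_pos μ 0 one_pos).ne'
  refine ⟨(μ (ball 0 1))⁻¹ * C, ENNReal.mul_ne_top (ENNReal.inv_ne_top.2 hβ0) hC,
    fun v g c x y ρ hg hv hx hy => ?_⟩
  have hρ := pos_of_mem_ball hx
  set J : E → ENNReal := fun p => ∫⁻ z in ball c ρ, g z * pw (dist z p)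
    (1 - Module.finrank ℝ E) ∂μ with hJ
  have hP0 := (pw_pos hρ (Module.finrank ℝ E)).ne'
  have hPt := pw_ne_top ρ (Module.finrank ℝ E)
  have hmeas : Measurable fun w =>
      ∫⁻ t in Ioo (0 : ℝ) 1, g (x + t • (w - x)) * ‖w - x‖ₑ := by
    refine Measurable.lintegral_prod_right ?_
    unfold Function.uncurry
    fun_prop
  have key : μ (ball 0 1) * pw ρ (Module.finrank ℝ E) * ‖v x - v y‖ₑ ≤
      pw ρ (Module.finrank ℝ E) * (C * (J x + J y)) := by
    calc μ (ball 0 1) * pw ρ (Module.finrank ℝ E) * ‖v x - v y‖ₑ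
        = ∫⁻ w in ball c ρ, ‖v x - v y‖ₑ ∂μ := by
          rw [setLIntegral_const, volume_ball_eq_mul_pw μ c hρ, mul_comm]
      _ ≤ ∫⁻ w in ball c ρ, ((∫⁻ t in Ioo (0 : ℝ) 1, g (x + t • (w - x)) * ‖w - x‖ₑ) +
            ∫⁻ t in Ioo (0 : ℝ) 1, g (y + t • (w - y)) * ‖w - y‖ₑ) ∂μ := by
          refine lintegral_mono fun w => ?_
          calc ‖v x - v y‖ₑ = ‖(v w - v y) - (v w - v x)‖ₑ := by congr 1; ring
            _ ≤ ‖v w - v y‖ₑ + ‖v w - v x‖ₑ := enorm_sub_le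
            _ ≤ _ := by
              rw [add_comm]
              exact add_le_add (hv x w) (hv y w)
      _ = _ := lintegral_add_left hmeas _
      _ ≤ C * pw ρ (Module.finrank ℝ E) * J x + C * pw ρ (Module.finrank ℝ E) * J y :=
          add_le_add (hCb g c x ρ hg hx) (hCb g c y ρ hg hy)
      _ = _ := by ring
  rw [mul_comm (μ _), mul_assoc, ENNReal.mul_le_mul_iff_right hP0 hPt] at key
  rwa [mul_assoc, ← ENNReal.mul_le_iff_le_inv hβ0 hβ]

lemma exists_enorm_le_weighted_riesz (μ : Measure E) [μ.IsAddHaarMeasure]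
    (hE : 1 < Module.finrank ℝ E) :
    ∃ C : ENNReal, C ≠ ⊤ ∧ ∀ (σ : Measure E) (F : Set E) (x : E) (A c : ENNReal) (v : E → ℝ)
      (g : E → ENNReal), SFinite σ → IsClosed F → F.Nonempty → 0 < infDist x F →
      (∀ᵐ y ∂σ, y ∈ F) →
      (∀ z ρ, 0 < ρ → σ (ball z ρ) ≤ A * pw ρ (Module.finrank ℝ E - 1)) →
      (∀ y ∈ F, ∀ ρ, 0 < ρ → ρ ≤ infDist x F →
        pw ρ (Module.finrank ℝ E - 1) ≤ c * σ (ball y ρ)) →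
      Measurable g → (∀ z ∈ F, g z = 0) → (∀ z ∈ F, v z = 0) →
      (∀ p w, ‖v w - v p‖ₑ ≤ ∫⁻ t in Ioo (0 : ℝ) 1, g (p + t • (w - p)) * ‖w - p‖ₑ) →
      ‖v x‖ₑ ≤ C * A * c *
        (∫⁻ z in ball x (infDist x F / 2), g z * pw (dist z x) (1 - Module.finrank ℝ E) ∂μ +
          pw (infDist x F) (1 - Module.finrank ℝ E + 1 / 4) *
            ∫⁻ z in ball x (2 * infDist x F), g z * pw (infDist z F) (-(1 / 4)) ∂μ) := by
  have : Nontrivial E := Module.nontrivial_of_finrank_pos (R := ℝ) (by omega)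
  set N : ℝ := (Module.finrank ℝ E : ℝ) with hN
  have hN1 : 1 < N := by
    rw [hN]
    exact_mod_cast hE
  obtain ⟨C₁, hC₁, hC₁b⟩ := exists_enorm_le_two_riesz μ
  obtain ⟨C₂, hC₂, hC₂b⟩ := exists_setLIntegral_ball_pw_one_sub_le E hN1.le
  rw [← hN] at hC₁b
  refine ⟨C₁ * (1 + pw (1 / 2) (1 - N) * pw 3 (1 / 4) + C₂ * pw 4 (1 / 4)),
    by simp only [ne_eq, ENNReal.mul_eq_top, ENNReal.add_eq_top, pw_ne_top, hC₁, hC₂]; simp,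
    fun σ F x A c v g _ hFc hFn hd hF hU hL hg hgF hvF hv => ?_⟩
  set d := infDist x F with hdd
  set J : E → ENNReal := fun p => ∫⁻ z in ball x (2 * d), g z * pw (dist z p) (1 - N) ∂μ with hJ
  set I₁ := ∫⁻ z in ball x (d / 2), g z * pw (dist z x) (1 - N) ∂μ with hI₁
  set I₂ := ∫⁻ z in ball x (2 * d), g z * pw (infDist z F) (-(1 / 4)) ∂μ with hI₂
  have hδm : Measurable fun z => infDist z F := measurable_infDist
  have hxB : x ∈ ball x (2 * d) := mem_ball_self (by positivity)
  obtain ⟨y₀, hy₀, hdy₀⟩ := hFc.exists_infDist_eq_dist hFn x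
  have hsub : ball y₀ d ⊆ ball x (2 * d) := ball_subset_ball' (by
    rw [dist_comm, ← hdy₀]; linarith)
  have hpt : ∀ z ∈ ball x (2 * d), g z ≠ 0 → 0 < infDist z F := by
    intro z _ hgz
    rw [← hFc.notMem_iff_infDist_pos hFn]
    exact fun h => hgz (hgF z h)
  have hJx : J x ≤ I₁ + pw (1 / 2) (1 - N) * pw 3 (1 / 4) * (pw d (1 - N + 1 / 4) * I₂) := by
    calc J x ≤ ∫⁻ z in ball x (2 * d),
          ((ball x (d / 2)).indicator (fun z => g z * pw (dist z x) (1 - N)) z +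
          pw (1 / 2) (1 - N) * pw 3 (1 / 4) * pw d (1 - N + 1 / 4) *
            (g z * pw (infDist z F) (-(1 / 4)))) ∂μ := by
          refine setLIntegral_mono' measurableSet_ball fun z hz => ?_
          by_cases hz2 : z ∈ ball x (d / 2)
          · rw [indicator_of_mem hz2]
            exact le_self_add
          by_cases hgz : g z = 0
          · simp [hgz]
          refine le_trans ?_ le_add_self
          have hδ := hpt z hz hgz
          have hδ3 : infDist z F ≤ 3 * d := by
            have h1 := infDist_le_infDist_add_dist (s := F) (x := z) (y := x)
            rw [mem_ball] at hz
            linarith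
          rw [mem_ball, not_lt] at hz2
          calc g z * pw (dist z x) (1 - N)
              ≤ g z * pw (1 / 2 * d) (1 - N) := by
                refine mul_le_mul_right (pw_le_pw_of_nonpos (by positivity) ?_ (by linarith)) _
                linarith
            _ = g z * pw (1 / 2 * d) (1 - N) *
                (pw (infDist z F) (1 / 4) * pw (infDist z F) (-(1 / 4))) := by
                rw [pw_mul_pw_neg hδ, mul_one]
            _ ≤ g z * pw (1 / 2 * d) (1 - N) *
                (pw (3 * d) (1 / 4) * pw (infDist z F) (-(1 / 4))) := by
                gcongr
                exact pw_le_pw_of_nonneg hδ.le hδ3 (by norm_num)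
            _ = _ := by
                rw [mul_pw (by norm_num) hd.le, mul_pw (by norm_num) hd.le, pw_add hd]
                ring
      _ = (∫⁻ z in ball x (2 * d),
            (ball x (d / 2)).indicator (fun z => g z * pw (dist z x) (1 - N)) z ∂μ) +
          pw (1 / 2) (1 - N) * pw 3 (1 / 4) * pw d (1 - N + 1 / 4) * I₂ := by
          rw [lintegral_add_left, lintegral_const_mul]
          · fun_prop
          · refine Measurable.indicator ?_ measurableSet_ball
            fun_prop
      _ ≤ _ := by
          rw [mul_assoc _ (pw d _) I₂]
          gcongr
          exact (setLIntegral_le_lintegral _ _).trans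
            (lintegral_indicator measurableSet_ball _).le
  have hJy : ∫⁻ y in ball y₀ d, J y ∂σ ≤ C₂ * A * pw (4 * d) (1 / 4) * I₂ := by
    calc ∫⁻ y in ball y₀ d, J y ∂σ
        = ∫⁻ z in ball x (2 * d), (∫⁻ y in ball y₀ d, g z * pw (dist z y) (1 - N) ∂σ) ∂μ := by
          apply lintegral_lintegral_swap
          refine Measurable.aemeasurable ?_
          unfold Function.uncurry
          fun_prop
      _ ≤ ∫⁻ z in ball x (2 * d),
            C₂ * A * pw (4 * d) (1 / 4) * (g z * pw (infDist z F) (-(1 / 4))) ∂μ := by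
          refine setLIntegral_mono' measurableSet_ball fun z hz => ?_
          by_cases hgz : g z = 0
          · simp [hgz]
          rw [lintegral_const_mul _ (by fun_prop)]
          have h1 := hC₂b σ F z A (4 * d) hF (hU z) (hpt z hz hgz)
          have h2 : ∫⁻ y in ball y₀ d, pw (dist z y) (1 - N) ∂σ ≤
              ∫⁻ y in ball z (4 * d), pw (dist y z) (1 - N) ∂σ := by
            simp_rw [dist_comm z]
            refine lintegral_mono_set (hsub.trans (ball_subset_ball' ?_))
            rw [mem_ball, dist_comm] at hz
            linarith
          refine (mul_le_mul_right (h2.trans h1) _).trans (le_of_eq (by ring))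
      _ = _ := lintegral_const_mul _ (by fun_prop)
  have havg : σ (ball y₀ d) * ‖v x‖ₑ ≤ C₁ * (σ (ball y₀ d) * J x + ∫⁻ y in ball y₀ d, J y ∂σ) := by
    calc σ (ball y₀ d) * ‖v x‖ₑ = ∫⁻ y in ball y₀ d, ‖v x‖ₑ ∂σ := by
          rw [setLIntegral_const, mul_comm]
      _ ≤ ∫⁻ y in ball y₀ d, C₁ * (J x + J y) ∂σ := by
          refine lintegral_mono_ae ?_
          filter_upwards [ae_restrict_mem measurableSet_ball, ae_restrict_of_ae hF] with y hy hyF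
          have := hC₁b v g x x y (2 * d) hg hv hxB (hsub hy)
          rwa [hvF y hyF, sub_zero] at this
      _ = _ := by
          have hJm : Measurable J := by
            refine Measurable.lintegral_prod_right ?_
            unfold Function.uncurry
            fun_prop
          rw [lintegral_const_mul _ (hJm.const_add _), lintegral_add_left measurable_const,
            setLIntegral_const, mul_comm (J x)]
  have hD0 := (pw_pos hd (N - 1)).ne'
  have hDt := pw_ne_top d (N - 1)
  rw [← ENNReal.mul_le_mul_iff_right hD0 hDt]
  have hneg : pw d (1 - N + 1 / 4) * pw d (N - 1) = pw d (1 / 4) := by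
    rw [← pw_add hd]; congr 1; ring
  calc pw d (N - 1) * ‖v x‖ₑ ≤ c * σ (ball y₀ d) * ‖v x‖ₑ :=
        mul_le_mul_left (hL y₀ hy₀ d hd le_rfl) _
    _ = c * (σ (ball y₀ d) * ‖v x‖ₑ) := by ring
    _ ≤ c * (C₁ * (A * pw d (N - 1) *
          (I₁ + pw (1 / 2) (1 - N) * pw 3 (1 / 4) * (pw d (1 - N + 1 / 4) * I₂)) +
          C₂ * A * pw (4 * d) (1 / 4) * I₂)) := by
        refine mul_le_mul_right (havg.trans ?_) _
        gcongr
        exact hU y₀ d hd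
    _ = C₁ * A * c * pw d (N - 1) * (I₁ + (pw (1 / 2) (1 - N) * pw 3 (1 / 4) + C₂ * pw 4 (1 / 4)) *
          (pw d (1 - N + 1 / 4) * I₂)) := by
        rw [mul_pw (by norm_num) hd.le, ← hneg]
        ring
    _ ≤ C₁ * A * c * pw d (N - 1) * ((1 + pw (1 / 2) (1 - N) * pw 3 (1 / 4) + C₂ * pw 4 (1 / 4)) *
          (I₁ + pw d (1 - N + 1 / 4) * I₂)) := by
        refine mul_le_mul_right ?_ _
        rw [mul_add (1 + _ + _)]
        refine add_le_add (le_mul_of_one_le_left zero_le ?_) (mul_le_mul_left ?_ _)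
        · rw [add_assoc]; exact le_self_add
        · rw [add_assoc]; exact le_add_self
    _ = _ := by ring

end Potential

/-- A positive kernel dominating the square of `u / δ` by the square of the gradient of `u`, where
`δ` is the distance to `F` and `N` is the dimension of the space. -/
def hardyKernel {E : Type*} [PseudoMetricSpace E] (F : Set E) (N : ℝ) (x z : E) : ENNReal :=
  (ball x (infDist x F / 2)).indicator (fun z => pw (infDist x F) (-1) * pw (dist z x) (1 - N)) z +
    (ball x (2 * infDist x F)).indicator
      (fun z => pw (infDist x F) (-(N + 1 / 4)) * pw (infDist z F) (1 / 4)) z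

lemma hardyKernel_eq_zero {E : Type*} [PseudoMetricSpace E] {F : Set E} {N : ℝ} {x z : E}
    (h : 2 * infDist x F ≤ dist z x) : hardyKernel F N x z = 0 := by
  have h0 := infDist_nonneg (x := x) (s := F)
  rw [hardyKernel, indicator_of_notMem, indicator_of_notMem, add_zero]
  · rwa [mem_ball, not_lt]
  · rw [mem_ball, not_lt]
    linarith

lemma measurable_hardyKernel {E : Type*} [PseudoMetricSpace E] [MeasurableSpace E] [BorelSpace E]
    [SecondCountableTopology E] (F : Set E) (N : ℝ) :
    Measurable (Function.uncurry (hardyKernel F N)) := by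
  have hδ : Measurable fun z => infDist z F := measurable_infDist
  have h1 : Measurable ({y : E × E | dist y.2 y.1 < infDist y.1 F / 2}.indicator
      fun y => pw (infDist y.1 F) (-1) * pw (dist y.2 y.1) (1 - N)) := by
    refine Measurable.indicator (by fun_prop) (measurableSet_lt ?_ ?_) <;> fun_prop
  have h2 : Measurable ({y : E × E | dist y.2 y.1 < 2 * infDist y.1 F}.indicator
      fun y => pw (infDist y.1 F) (-(N + 1 / 4)) * pw (infDist y.2 F) (1 / 4)) := by
    refine Measurable.indicator (by fun_prop) (measurableSet_lt ?_ ?_) <;> fun_prop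
  exact h1.add h2

section Potential

variable {E : Type*} [NormedAddCommGroup E] [NormedSpace ℝ E] [FiniteDimensional ℝ E]
  [MeasurableSpace E] [BorelSpace E]

lemma exists_lintegral_hardyKernel_le (μ : Measure E) [μ.IsAddHaarMeasure]
    (hE : 1 < Module.finrank ℝ E) :
    ∃ C : ENNReal, C ≠ ⊤ ∧ ∀ (F : Set E) (z : E), 0 < infDist z F →
      ∫⁻ x, hardyKernel F (Module.finrank ℝ E) x z ∂μ ≤ C := by
  have : Nontrivial E := Module.nontrivial_of_finrank_pos (R := ℝ) (by omega)
  set N : ℝ := (Module.finrank ℝ E : ℝ) with hN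
  have hN1 : 1 < N := by
    rw [hN]
    exact_mod_cast hE
  obtain ⟨C₁, hC₁, hC₁b⟩ := exists_setLIntegral_ball_pw_dist_le E (m := N) (p := N - 1)
    (by linarith) (by linarith)
  obtain ⟨C₂, hC₂, hC₂b⟩ := exists_setLIntegral_compl_ball_pw_dist_le E (m := N) (p := N + 1 / 4)
    (by linarith) (by linarith)
  set β := μ (ball 0 1) with hβdef
  have hβ : β ≠ ⊤ := measure_ball_lt_top.ne
  refine ⟨pw (2 / 3) (-1) * C₁ * β + (pw (1 / 3) (-(N + 1 / 4)) * β +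
      pw (1 / 2) (-(N + 1 / 4)) * C₂ * β),
    by simp only [ne_eq, ENNReal.mul_eq_top, ENNReal.add_eq_top, pw_ne_top, hC₁, hC₂, hβ]; simp,
    fun F z hδ => ?_⟩
  set δ := infDist z F with hδdef
  have hvol : ∀ ρ, 0 < ρ → μ (ball z ρ) ≤ β * pw ρ N := fun ρ hρ =>
    (volume_ball_eq_mul_pw μ z hρ).le
  have hm : Measurable fun x : E => infDist x F := measurable_infDist
  calc ∫⁻ x, hardyKernel F N x z ∂μ
      ≤ ∫⁻ x, ((ball z δ).indicator
            (fun x => pw (2 / 3 * δ) (-1) * pw (dist x z) (-(N - 1))) x +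
          ((ball z δ).indicator (fun _ => pw (1 / 3 * δ) (-(N + 1 / 4)) * pw δ (1 / 4)) x +
            (ball z δ)ᶜ.indicator (fun x => pw (1 / 2) (-(N + 1 / 4)) * pw δ (1 / 4) *
              pw (dist x z) (-(N + 1 / 4))) x)) ∂μ := by
        refine lintegral_mono fun x => add_le_add ?_ ?_
        · by_cases hz : z ∈ ball x (infDist x F / 2)
          swap
          · rw [indicator_of_notMem hz]; exact zero_le
          have hz' : dist z x < infDist x F / 2 := mem_ball.1 hz
          have h1 := infDist_le_infDist_add_dist (s := F) (x := z) (y := x)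
          have h2 := infDist_le_infDist_add_dist (s := F) (x := x) (y := z)
          have hx : x ∈ ball z δ := by
            rw [mem_ball]
            rw [dist_comm] at h1
            linarith [dist_comm x z]
          rw [indicator_of_mem hz, indicator_of_mem hx, dist_comm z x, neg_sub]
          refine mul_le_mul_left (pw_le_pw_of_nonpos (by positivity) ?_ (by norm_num)) _
          linarith
        · by_cases hz : z ∈ ball x (2 * infDist x F)
          swap
          · rw [indicator_of_notMem hz]; exact zero_le
          have hz' := mem_ball.1 hz
          have h1 := infDist_le_infDist_add_dist (s := F) (x := z) (y := x)
          rw [indicator_of_mem hz]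
          by_cases hx : x ∈ ball z δ
          · rw [indicator_of_mem hx]
            refine le_trans ?_ le_self_add
            refine mul_le_mul_left (pw_le_pw_of_nonpos (by positivity) ?_ (by linarith)) _
            linarith
          · rw [indicator_of_mem (mem_compl hx)]
            refine le_trans ?_ le_add_self
            rw [mem_ball, not_lt] at hx
            have hpos : 0 < dist x z := hδ.trans_le hx
            rw [mul_right_comm, ← mul_pw (by norm_num) hpos.le]
            refine mul_le_mul_left (pw_le_pw_of_nonpos (by positivity) ?_ (by linarith)) _
            rw [dist_comm x z]
            linarith
    _ = pw (2 / 3 * δ) (-1) * ∫⁻ x in ball z δ, pw (dist x z) (-(N - 1)) ∂μ +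
          (pw (1 / 3 * δ) (-(N + 1 / 4)) * pw δ (1 / 4) * μ (ball z δ) +
            pw (1 / 2) (-(N + 1 / 4)) * pw δ (1 / 4) *
              ∫⁻ x in (ball z δ)ᶜ, pw (dist x z) (-(N + 1 / 4)) ∂μ) := by
        have hm1 : Measurable fun x : E => pw (dist x z) (-(N - 1)) := by fun_prop
        have hm2 : Measurable fun x : E => pw (dist x z) (-(N + 1 / 4)) := by fun_prop
        rw [lintegral_add_left ((hm1.const_mul _).indicator measurableSet_ball),
          lintegral_add_left (measurable_const.indicator measurableSet_ball),
          lintegral_indicator measurableSet_ball, lintegral_indicator measurableSet_ball,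
          lintegral_indicator measurableSet_ball.compl, lintegral_const_mul _ hm1,
          lintegral_const_mul _ hm2, setLIntegral_const]
    _ ≤ pw (2 / 3 * δ) (-1) * (C₁ * β * pw δ (N - (N - 1))) +
          (pw (1 / 3 * δ) (-(N + 1 / 4)) * pw δ (1 / 4) * (β * pw δ N) +
            pw (1 / 2) (-(N + 1 / 4)) * pw δ (1 / 4) *
              (C₂ * β * pw δ (N - (N + 1 / 4)))) := by
        gcongr
        · exact hC₁b μ z β δ hδ hvol
        · exact hvol δ hδ
        · exact hC₂b μ z β δ hδ hvol
    _ = pw (2 / 3) (-1) * C₁ * β * (pw δ 1 * pw δ (-1)) +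
          (pw (1 / 3) (-(N + 1 / 4)) * β * (pw δ (N + 1 / 4) * pw δ (-(N + 1 / 4))) +
            pw (1 / 2) (-(N + 1 / 4)) * C₂ * β * (pw δ (1 / 4) * pw δ (-(1 / 4)))) := by
        rw [sub_sub_cancel, sub_add_cancel_left, mul_pw (by norm_num) hδ.le,
          mul_pw (by norm_num) hδ.le, pw_add hδ N (1 / 4)]
        ring
    _ = _ := by rw [pw_mul_pw_neg hδ, pw_mul_pw_neg hδ, pw_mul_pw_neg hδ, mul_one, mul_one, mul_one]

lemma exists_enorm_sq_le_hardyKernel (μ : Measure E) [μ.IsAddHaarMeasure]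
    (hE : 1 < Module.finrank ℝ E) {A c : ENNReal} (hA : A ≠ ⊤) (hc : c ≠ ⊤) :
    ∃ C : ENNReal, C ≠ ⊤ ∧ ∀ (σ : Measure E) (F : Set E) (x : E) (v : E → ℝ)
      (g : E → ENNReal), SFinite σ → IsClosed F → F.Nonempty → 0 < infDist x F →
      (∀ᵐ y ∂σ, y ∈ F) →
      (∀ z ρ, 0 < ρ → σ (ball z ρ) ≤ A * pw ρ (Module.finrank ℝ E - 1)) →
      (∀ y ∈ F, ∀ ρ, 0 < ρ → ρ ≤ infDist x F →
        pw ρ (Module.finrank ℝ E - 1) ≤ c * σ (ball y ρ)) →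
      Measurable g → (∀ z ∈ F, g z = 0) → (∀ z ∈ F, v z = 0) →
      (∀ p w, ‖v w - v p‖ₑ ≤ ∫⁻ t in Ioo (0 : ℝ) 1, g (p + t • (w - p)) * ‖w - p‖ₑ) →
      pw (infDist x F) (-2) * ‖v x‖ₑ ^ 2 ≤
        C * ∫⁻ z, g z ^ 2 * hardyKernel F (Module.finrank ℝ E) x z ∂μ := by
  have : Nontrivial E := Module.nontrivial_of_finrank_pos (R := ℝ) (by omega)
  set N : ℝ := (Module.finrank ℝ E : ℝ) with hN
  have hN1 : 1 < N := by
    rw [hN]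
    exact_mod_cast hE
  obtain ⟨C₁, hC₁, hC₁b⟩ := exists_enorm_le_weighted_riesz μ hE
  obtain ⟨C₂, hC₂, hC₂b⟩ := exists_setLIntegral_ball_pw_dist_le E (m := N) (p := N - 1)
    (by linarith) (by linarith)
  obtain ⟨C₃, hC₃, hC₃b⟩ := exists_setLIntegral_pw_infDist_le μ
  rw [← hN] at hC₁b hC₃b
  set β := μ (ball 0 1) with hβdef
  have hβ : β ≠ ⊤ := measure_ball_lt_top.ne
  refine ⟨(C₁ * A * c) ^ 2 * 4 * (C₂ * β * pw (1 / 2) 1 + C₃ * A * c),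
    by simp only [ne_eq, ENNReal.mul_eq_top, ENNReal.add_eq_top, ENNReal.pow_eq_top_iff, pw_ne_top,
        hC₁, hC₂, hC₃, hβ, hA, hc]; simp,
    fun σ F x v g hσ hFc hFn hd hF hU hL hg hgF hvF hv => ?_⟩
  have h1 := hC₁b σ F x A c v g hσ hFc hFn hd hF hU hL hg hgF hvF hv
  have h3 := hC₃b σ F x A c hσ hFc hFn hd hU hL
  have hδm : Measurable fun z => infDist z F := measurable_infDist
  have hker : ∀ z, hardyKernel F N x z =
    (ball x (infDist x F / 2)).indicator
      (fun z => pw (infDist x F) (-1) * pw (dist z x) (1 - N)) z +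
    (ball x (2 * infDist x F)).indicator
      (fun z => pw (infDist x F) (-(N + 1 / 4)) * pw (infDist z F) (1 / 4)) z := fun z => rfl
  set d := infDist x F with hdd
  set I₁ := ∫⁻ z in ball x (d / 2), g z * pw (dist z x) (1 - N) ∂μ with hI₁
  set I₂ := ∫⁻ z in ball x (2 * d), g z * pw (infDist z F) (-(1 / 4)) ∂μ with hI₂
  set K₁ := ∫⁻ z in ball x (d / 2), g z ^ 2 * pw (dist z x) (1 - N) ∂μ with hK₁
  set K₂ := ∫⁻ z in ball x (2 * d), g z ^ 2 * pw (infDist z F) (1 / 4) ∂μ with hK₂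
  have hI₁K : I₁ ^ 2 ≤ K₁ * (C₂ * β * pw (1 / 2 * d) 1) := by
    have e : ∀ z, pw (dist z x) ((1 - N) / 2) ^ 2 = pw (dist z x) (1 - N) := fun z => by
      rw [pw_sq dist_nonneg, div_mul_cancel₀ _ two_ne_zero]
    calc I₁ ^ 2 = (∫⁻ z in ball x (d / 2), (g z * pw (dist z x) ((1 - N) / 2)) *
          pw (dist z x) ((1 - N) / 2) ∂μ) ^ 2 := by
          simp_rw [mul_assoc, ← sq, e]
          rfl
      _ ≤ _ := sq_lintegral_mul_le (by fun_prop) (by fun_prop)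
      _ = K₁ * ∫⁻ z in ball x (d / 2), pw (dist z x) (-(N - 1)) ∂μ := by
          simp_rw [mul_pow, e, neg_sub]
          rfl
      _ ≤ _ := by
          gcongr
          have := hC₂b μ x β (d / 2) (by positivity) fun ρ hρ => (volume_ball_eq_mul_pw μ x hρ).le
          rw [sub_sub_cancel] at this
          rwa [show 1 / 2 * d = d / 2 by ring]
  have hI₂K : I₂ ^ 2 ≤ K₂ * (C₃ * A * c * pw d (N - 3 / 4)) := by
    calc I₂ ^ 2 = (∫⁻ z in ball x (2 * d), (g z * pw (infDist z F) (1 / 8)) *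
          pw (infDist z F) (-(3 / 8)) ∂μ) ^ 2 := by
          congr 1
          refine lintegral_congr fun z => ?_
          rcases (infDist_nonneg (x := z) (s := F)).eq_or_lt with h0 | h0
          · rw [← h0, pw_zero_left (by norm_num), pw_zero_left (by norm_num), mul_zero, zero_mul]
          · rw [mul_assoc, ← pw_add h0]
            norm_num
      _ ≤ _ := sq_lintegral_mul_le (by fun_prop) (by fun_prop)
      _ = K₂ * ∫⁻ z in ball x (2 * d), pw (infDist z F) (-(3 / 4)) ∂μ := by
          simp_rw [mul_pow, pw_sq infDist_nonneg]
          norm_num [hK₂]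
      _ ≤ _ := by gcongr
  have hK : ∫⁻ z, g z ^ 2 * hardyKernel F N x z ∂μ =
      pw d (-1) * K₁ + pw d (-(N + 1 / 4)) * K₂ := by
    simp_rw [hker, mul_add]
    rw [lintegral_add_left]
    · rw [hK₁, hK₂, ← lintegral_const_mul _ (by fun_prop), ← lintegral_const_mul _ (by fun_prop),
        ← lintegral_indicator measurableSet_ball, ← lintegral_indicator measurableSet_ball]
      congr 1
      · refine lintegral_congr fun z => ?_
        by_cases hz : z ∈ ball x (d / 2)
        · rw [indicator_of_mem hz, indicator_of_mem hz]; ring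
        · rw [indicator_of_notMem hz, indicator_of_notMem hz, mul_zero]
      · refine lintegral_congr fun z => ?_
        by_cases hz : z ∈ ball x (2 * d)
        · rw [indicator_of_mem hz, indicator_of_mem hz]; ring
        · rw [indicator_of_notMem hz, indicator_of_notMem hz, mul_zero]
    · refine (hg.pow_const 2).mul (Measurable.indicator ?_ measurableSet_ball)
      fun_prop
  rw [hK]
  calc pw d (-2) * ‖v x‖ₑ ^ 2
      ≤ pw d (-2) * (C₁ * A * c * (I₁ + pw d (1 - N + 1 / 4) * I₂)) ^ 2 := by gcongr
    _ ≤ pw d (-2) * ((C₁ * A * c) ^ 2 *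
          (4 * (I₁ ^ 2 + pw d ((1 - N + 1 / 4) * 2) * I₂ ^ 2))) := by
        rw [mul_pow]
        gcongr
        refine (ENNReal.add_sq_le_four_mul _ _).trans (le_of_eq ?_)
        rw [mul_pow, pw_sq hd.le]
    _ ≤ pw d (-2) * ((C₁ * A * c) ^ 2 * (4 * (K₁ * (C₂ * β * pw (1 / 2 * d) 1) +
          pw d ((1 - N + 1 / 4) * 2) * (K₂ * (C₃ * A * c * pw d (N - 3 / 4)))))) := by
        gcongr
    _ = (C₁ * A * c) ^ 2 * 4 * (C₂ * β * pw (1 / 2) 1 * (pw d (-1) * K₁) +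
          C₃ * A * c * (pw d (-(N + 1 / 4)) * K₂)) := by
        have e1 : pw d (-2) * pw d 1 = pw d (-1) := by
          rw [← pw_add hd]; norm_num
        have e2 : pw d (-2) * pw d ((1 - N + 1 / 4) * 2) * pw d (N - 3 / 4) =
            pw d (-(N + 1 / 4)) := by
          rw [← pw_add hd, ← pw_add hd]; congr 1; ring
        rw [mul_pw (by norm_num) hd.le, ← e1, ← e2]
        ring
    _ ≤ (C₁ * A * c) ^ 2 * 4 * ((C₂ * β * pw (1 / 2) 1 + C₃ * A * c) * (pw d (-1) * K₁) +
          (C₂ * β * pw (1 / 2) 1 + C₃ * A * c) * (pw d (-(N + 1 / 4)) * K₂)) := by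
        gcongr
        · exact le_self_add
        · exact le_add_self
    _ = _ := by ring

lemma exists_setLIntegral_hardy_le (μ : Measure E) [μ.IsAddHaarMeasure]
    (hE : 1 < Module.finrank ℝ E) {A c : ENNReal} (hA : A ≠ ⊤) (hc : c ≠ ⊤) :
    ∃ C : ENNReal, C ≠ ⊤ ∧ ∀ (σ : Measure E) (F : Set E) (q : E) (r : ℝ) (v : E → ℝ)
      (g : E → ENNReal), SFinite σ → IsClosed F → q ∈ F →
      (∀ᵐ y ∂σ, y ∈ F) →
      (∀ z ρ, 0 < ρ → σ (ball z ρ) ≤ A * pw ρ (Module.finrank ℝ E - 1)) →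
      (∀ y ∈ F, ∀ ρ, 0 < ρ → ρ ≤ r →
        pw ρ (Module.finrank ℝ E - 1) ≤ c * σ (ball y ρ)) →
      Measurable g → (∀ z ∈ F, g z = 0) → (∀ z ∈ F, v z = 0) →
      (∀ p w, ‖v w - v p‖ₑ ≤ ∫⁻ t in Ioo (0 : ℝ) 1, g (p + t • (w - p)) * ‖w - p‖ₑ) →
      ∫⁻ x in ball q r, pw (infDist x F) (-2) * ‖v x‖ₑ ^ 2 ∂μ ≤
        C * ∫⁻ z in ball q (3 * r), g z ^ 2 ∂μ := by
  obtain ⟨C₁, hC₁, hC₁b⟩ := exists_enorm_sq_le_hardyKernel μ hE hA hc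
  obtain ⟨C₂, hC₂, hC₂b⟩ := exists_lintegral_hardyKernel_le μ hE
  refine ⟨C₁ * C₂, ENNReal.mul_ne_top hC₁ hC₂,
    fun σ F q r v g hσ hFc hq hF hU hL hg hgF hvF hv => ?_⟩
  set N : ℝ := (Module.finrank ℝ E : ℝ) with hN
  have hkm := measurable_hardyKernel F N
  calc ∫⁻ x in ball q r, pw (infDist x F) (-2) * ‖v x‖ₑ ^ 2 ∂μ
      ≤ ∫⁻ x in ball q r,
          C₁ * (∫⁻ z in ball q (3 * r), g z ^ 2 * hardyKernel F N x z ∂μ) ∂μ := by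
        refine setLIntegral_mono' measurableSet_ball fun x hx => ?_
        have hxq : infDist x F ≤ dist x q := infDist_le_dist_of_mem hq
        rw [mem_ball] at hx
        rcases (infDist_nonneg (x := x) (s := F)).eq_or_lt with h0 | h0
        · rw [← h0, pw_zero_left (by norm_num), zero_mul]
          exact zero_le
        refine (hC₁b σ F x v g hσ hFc ⟨q, hq⟩ h0 hF hU
          (fun y hy ρ hρ hle => hL y hy ρ hρ (by linarith)) hg hgF hvF hv).trans
          (mul_le_mul_right ?_ _)
        rw [← lintegral_indicator measurableSet_ball]
        refine lintegral_mono fun z => ?_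
        by_cases hz : z ∈ ball q (3 * r)
        · rw [indicator_of_mem hz]
        · rw [hardyKernel_eq_zero, mul_zero]
          · exact zero_le
          · have := dist_triangle z x q
            rw [mem_ball, not_lt] at hz
            linarith
    _ = C₁ * ∫⁻ x in ball q r,
          (∫⁻ z in ball q (3 * r), g z ^ 2 * hardyKernel F N x z ∂μ) ∂μ := by
        refine lintegral_const_mul _ (Measurable.lintegral_prod_right ?_)
        exact ((hg.pow_const 2).comp measurable_snd).mul hkm
    _ = C₁ * ∫⁻ z in ball q (3 * r),
          (∫⁻ x in ball q r, g z ^ 2 * hardyKernel F N x z ∂μ) ∂μ := by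
        rw [lintegral_lintegral_swap]
        exact (((hg.pow_const 2).comp measurable_snd).mul hkm).aemeasurable
    _ ≤ C₁ * ∫⁻ z in ball q (3 * r), C₂ * g z ^ 2 ∂μ := by
        refine mul_le_mul_right (lintegral_mono fun z => ?_) _
        by_cases hgz : g z = 0
        · simp [hgz]
        have hkz : Measurable fun x => hardyKernel F N x z := hkm.comp measurable_prodMk_right
        rw [lintegral_const_mul _ hkz, mul_comm C₂]
        refine mul_le_mul_right ((setLIntegral_le_lintegral _ _).trans (hC₂b F z ?_)) _
        rw [← hFc.notMem_iff_infDist_pos ⟨q, hq⟩]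
        exact fun h => hgz (hgF z h)
    _ = _ := by rw [lintegral_const_mul _ (hg.pow_const 2), mul_assoc]

end Potential

lemma IsADR.measure_ball_inter_le {n : ℕ} (hn : 1 ≤ n) {F : Set (EuclideanSpace ℝ (Fin n))}
    {CAR : ℝ} (hCAR : 0 ≤ CAR) (h : IsADR F CAR) {q : EuclideanSpace ℝ (Fin n)} (hq : q ∈ F)
    {r : ℝ} (hr : 0 < r) (hrF : ENNReal.ofReal r ≤ Metric.ediam F) :
    μH[(n : ℝ) - 1] (ball q r ∩ F) ≤ ENNReal.ofReal CAR * pw r ((n : ℝ) - 1) := by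
  refine (h q hq r hr hrF).2.trans_eq ?_
  rw [ENNReal.ofReal_mul hCAR, ← pw_natCast, Nat.cast_sub hn, Nat.cast_one]

lemma IsADR.pw_le_measure_ball_inter {n : ℕ} (hn : 1 ≤ n)
    {F : Set (EuclideanSpace ℝ (Fin n))} {CAR : ℝ} (hCAR : 0 < CAR) (h : IsADR F CAR)
    {q : EuclideanSpace ℝ (Fin n)} (hq : q ∈ F) {r : ℝ} (hr : 0 < r)
    (hrF : ENNReal.ofReal r ≤ Metric.ediam F) :
    pw r ((n : ℝ) - 1) ≤ ENNReal.ofReal CAR * μH[(n : ℝ) - 1] (ball q r ∩ F) := by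
  refine le_trans (le_of_eq ?_) (mul_le_mul_right (h q hq r hr hrF).1 _)
  rw [← ENNReal.ofReal_mul hCAR.le, mul_inv_cancel_left₀ hCAR.ne', ← pw_natCast,
    Nat.cast_sub hn, Nat.cast_one]

lemma isLocallyFiniteMeasure_of_ball_le {X : Type*} [PseudoMetricSpace X] [MeasurableSpace X]
    {σ : Measure X} {A : ENNReal} {m : ℝ} (hA : A ≠ ⊤)
    (h : ∀ z ρ, 0 < ρ → σ (ball z ρ) ≤ A * pw ρ m) : IsLocallyFiniteMeasure σ :=
  ⟨fun z => ⟨ball z 1, ball_mem_nhds z one_pos,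
    (h z 1 one_pos).trans_lt (ENNReal.mul_lt_top hA.lt_top (pw_ne_top _ _).lt_top)⟩⟩

/-- The local Hardy inequality, in terms of lower Lebesgue integrals. -/
lemma exists_setLIntegral_bdryDist_le {n : ℕ} (hn : 1 < n) {CAR : ℝ} (hCAR : 0 < CAR) :
    ∃ C : ENNReal, C ≠ ⊤ ∧ ∀ Ω : Set (EuclideanSpace ℝ (Fin n)), IsOpen Ω →
      IsADR (frontier Ω) CAR → ∀ q ∈ frontier Ω, ∀ r : ℝ, 0 < r →
      ENNReal.ofReal r ≤ Metric.ediam (frontier Ω) →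
      ∀ u : EuclideanSpace ℝ (Fin n) → ℝ, ContinuousOn u (closure Ω) →
        (∀ x ∈ Ω, DifferentiableAt ℝ u x) → (∀ x ∈ frontier Ω, u x = 0) →
        ∫⁻ x in Ω ∩ ball q r, ENNReal.ofReal ((u x / bdryDist Ω x) ^ 2) ≤
          C * ∫⁻ x in Ω ∩ ball q (3 * r), ENNReal.ofReal (‖gradient u x‖ ^ 2) := by
  have hfin : Module.finrank ℝ (EuclideanSpace ℝ (Fin n)) = n := finrank_euclideanSpace_fin
  set A : ENNReal := 5 ^ n * pw 2 ((n : ℝ) - 1) * ENNReal.ofReal CAR with hAdef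
  have hA : A ≠ ⊤ := by
    refine ENNReal.mul_ne_top (ENNReal.mul_ne_top ?_ (pw_ne_top _ _)) ENNReal.ofReal_ne_top
    exact ENNReal.pow_ne_top (by norm_num)
  obtain ⟨C, hC, hCb⟩ := exists_setLIntegral_hardy_le
    (volume : Measure (EuclideanSpace ℝ (Fin n))) (by rwa [hfin]) hA
    (ENNReal.ofReal_ne_top (r := CAR))
  rw [hfin] at hCb
  refine ⟨C, hC, fun Ω hΩ hADR q hq r hr hrF u huc hud hu0 => ?_⟩
  have hdisj : ∀ z ∈ frontier Ω, z ∉ Ω := fun z hz hzΩ => by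
    rw [hΩ.frontier_eq] at hz
    exact hz.2 hzΩ
  have hpos : ∀ x ∈ Ω, 0 < infDist x (frontier Ω) := fun x hx =>
    (isClosed_frontier.notMem_iff_infDist_pos ⟨q, hq⟩).1 fun h => hdisj x h hx
  have hU : ∀ z ρ, 0 < ρ →
      (μH[(n : ℝ) - 1] : Measure (EuclideanSpace ℝ (Fin n))).restrict (frontier Ω) (ball z ρ) ≤
        A * pw ρ ((n : ℝ) - 1) := by
    intro z ρ hρ
    have hn1 : (0 : ℝ) ≤ (n : ℝ) - 1 := by
      rw [sub_nonneg]
      exact_mod_cast hn.le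
    have := restrict_ball_le_of_ball_le hn1 ((ENNReal.ofReal_pos.2 hr).trans_le hrF).ne'
      (fun q hq r hr hrF => hADR.measure_ball_inter_le hn.le hCAR.le hq hr hrF) z hρ
    rwa [hfin] at this
  have hloc := isLocallyFiniteMeasure_of_ball_le hA hU
  have key := hCb ((μH[(n : ℝ) - 1]).restrict (frontier Ω)) (frontier Ω) q r (Ω.indicator u)
    (Ω.indicator fun z => ‖fderiv ℝ u z‖ₑ) inferInstance isClosed_frontier hq
    (ae_restrict_mem isClosed_frontier.measurableSet) hU
    (fun y hy ρ hρ hρr => by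
      rw [Measure.restrict_apply measurableSet_ball]
      exact hADR.pw_le_measure_ball_inter hn.le hCAR hy hρ
        ((ENNReal.ofReal_le_ofReal hρr).trans hrF))
    ((measurable_fderiv ℝ u).enorm.indicator hΩ.measurableSet)
    (fun z hz => indicator_of_notMem (hdisj z hz) _)
    (fun z hz => indicator_of_notMem (hdisj z hz) _)
    (enorm_indicator_sub_le_lintegral_fderiv hΩ huc hud hu0)
  calc ∫⁻ x in Ω ∩ ball q r, ENNReal.ofReal ((u x / bdryDist Ω x) ^ 2)
      = ∫⁻ x in Ω ∩ ball q r,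
          pw (infDist x (frontier Ω)) (-2) * ‖Ω.indicator u x‖ₑ ^ 2 := by
        refine setLIntegral_congr_fun (hΩ.measurableSet.inter measurableSet_ball) fun x hx => ?_
        have h := hpos x hx.1
        rw [indicator_of_mem hx.1, ← ofReal_norm, ← ENNReal.ofReal_pow (norm_nonneg _),
          pw, ← ENNReal.ofReal_mul (by positivity), Real.norm_eq_abs, sq_abs,
          Real.rpow_neg h.le, Real.rpow_two, bdryDist, div_pow, div_eq_inv_mul]
    _ ≤ ∫⁻ x in ball q r, pw (infDist x (frontier Ω)) (-2) * ‖Ω.indicator u x‖ₑ ^ 2 :=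
        lintegral_mono_set inter_subset_right
    _ ≤ _ := key
    _ = C * ∫⁻ x in Ω ∩ ball q (3 * r), ENNReal.ofReal (‖gradient u x‖ ^ 2) := by
        rw [← lintegral_indicator measurableSet_ball,
          ← lintegral_indicator (hΩ.measurableSet.inter measurableSet_ball)]
        congr 1
        refine lintegral_congr fun x => ?_
        have hg : ‖gradient u x‖ = ‖fderiv ℝ u x‖ := LinearIsometryEquiv.norm_map _ _
        rw [inter_comm, ← indicator_indicator]
        by_cases hx : x ∈ ball q (3 * r)
        · rw [indicator_of_mem hx, indicator_of_mem hx]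
          by_cases hxΩ : x ∈ Ω
          · rw [indicator_of_mem hxΩ, indicator_of_mem hxΩ, hg, ← ofReal_norm,
              ENNReal.ofReal_pow (norm_nonneg _)]
          · rw [indicator_of_notMem hxΩ, indicator_of_notMem hxΩ, zero_pow two_ne_zero]
        · rw [indicator_of_notMem hx, indicator_of_notMem hx]

/-- Local Hardy inequality on open sets with Ahlfors–David regular boundary
(ball formulation of the paper's Theorem 3.1). -/
theorem local_hardy_inequality (n : ℕ) (hn : 3 ≤ n) (CAR : ℝ) (hCAR : 1 < CAR) :
    ∃ C : ℝ, ∃ K : ℝ, 1 ≤ C ∧ 1 ≤ K ∧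
      ∀ (Ω : Set (EuclideanSpace ℝ (Fin n))), IsOpen Ω → Ω.Nonempty →
        IsADR (frontier Ω) CAR →
        ∀ q ∈ frontier Ω, ∀ r : ℝ, 0 < r → ENNReal.ofReal r ≤ EMetric.diam (frontier Ω) →
        ∀ u : EuclideanSpace ℝ (Fin n) → ℝ,
          ContinuousOn u (closure Ω) →
          (∀ x ∈ Ω, DifferentiableAt ℝ u x) →
          IntegrableOn (fun x => (u x) ^ 2) Ω volume →
          IntegrableOn (fun x => ‖gradient u x‖ ^ 2) Ω volume →
          (∀ x ∈ frontier Ω, u x = 0) →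
          ∫ x in Ω ∩ Metric.ball q r, (u x / bdryDist Ω x) ^ 2 ≤
            C * ∫ x in Ω ∩ Metric.ball q (K * r), ‖gradient u x‖ ^ 2 := by
  obtain ⟨C, hC, hCb⟩ := exists_setLIntegral_bdryDist_le (n := n) (by omega)
    (zero_lt_one.trans hCAR)
  refine ⟨C.toReal + 1, 3, by linarith [C.toReal_nonneg], by norm_num, ?_⟩
  intro Ω hΩ _ hADR q hq r hr hrF u huc hud _ hgu hu0
  have hR : 0 ≤ ∫ x in Ω ∩ ball q (3 * r), ‖gradient u x‖ ^ 2 :=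
    integral_nonneg fun x => sq_nonneg _
  have hRi : IntegrableOn (fun x => ‖gradient u x‖ ^ 2) (Ω ∩ ball q (3 * r)) volume :=
    hgu.mono_set inter_subset_left
  by_cases hL : IntegrableOn (fun x => (u x / bdryDist Ω x) ^ 2) (Ω ∩ ball q r) volume
  swap
  · rw [integral_undef hL]
    have := C.toReal_nonneg
    positivity
  have h := hCb Ω hΩ hADR q hq r hr hrF u huc hud hu0
  rw [← ofReal_integral_eq_lintegral_ofReal hL (Filter.Eventually.of_forall fun x => sq_nonneg _),
    ← ofReal_integral_eq_lintegral_ofReal hRi (Filter.Eventually.of_forall fun x => sq_nonneg _),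
    ← ENNReal.ofReal_toReal hC, ← ENNReal.ofReal_mul C.toReal_nonneg,
    ENNReal.ofReal_le_ofReal_iff (mul_nonneg C.toReal_nonneg hR)] at h
  exact h.trans (mul_le_mul_of_nonneg_right (by linarith) hR)
end
end
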